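/- arXiv:2604.19067 — 3 statements merged into one kernel-verified Lean document; each statement's English description precedes it below -/
import Mathlib

section
/- In the geometric block model G_n(r_s, r_d) with community sizes m = τn and n−m, and radii satisfying 0 ≤ r_d, 2r_d ≤ r_s ≤ 1/4, the expected number of ordered triangles satisfies the exact identity: Σ_{i≠j≠k} E[A_ij A_jk A_ki] = 3r_s²·[m(m−1)(m−2) + (n−m)(n−m−1)(n−m−2)] + 12 r_d²·[m(m−1)(n−m) + m(n−m)(n−m−1)], where the sum ranges over ordered triples (i,j,k) of pairwise distinct vertices in {1,…,n}. -/
open MeasureTheory Finset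

noncomputable section

/-- The periodic distance on `[0,1]`: `d(u,v) = min(|u-v|, 1-|u-v|)`. -/
def pdist (u v : ℝ) : ℝ := min |u - v| (1 - |u - v|)

/-- The law of `(X_1, …, X_n)`: the product of `n` uniform measures on `[0,1]`. -/
def gbmMeasure (n : ℕ) : Measure (Fin n → ℝ) :=
  Measure.pi fun _ => volume.restrict (Set.Icc (0 : ℝ) 1)

/-- The adjacency matrix of the geometric block model `G_n(r_s, r_d)` with
communities `V₁ = {0,…,m-1}` and `V₂ = {m,…,n-1}`: `A i i = 0`, and for `i ≠ j`,
`A i j = 1[d(X_i,X_j) ≤ r_s]` if `i, j` are in the same community and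
`A i j = 1[d(X_i,X_j) ≤ r_d]` otherwise. -/
def gbmA (n m : ℕ) (rs rd : ℝ) (X : Fin n → ℝ) (i j : Fin n) : ℝ :=
  if i = j then 0
  else if ((i : ℕ) < m ↔ (j : ℕ) < m) then
    (if pdist (X i) (X j) ≤ rs then 1 else 0)
  else (if pdist (X i) (X j) ≤ rd then 1 else 0)


def gK (r t : ℝ) : ℝ := if |t - round t| ≤ r then 1 else 0

lemma gK_add_one (r t : ℝ) : gK r (t + 1) = gK r t := by
  unfold gK
  rw [round_add_one]; push_cast
  congr 2; ring_nf

lemma gK_neg (r t : ℝ) : gK r (-t) = gK r t := by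
  unfold gK
  rw [← UnitAddCircle.norm_eq, ← UnitAddCircle.norm_eq]
  simp

lemma abs_round_half (t : ℝ) (h : |t| ≤ 1/2) : |t - round t| = |t| := by
  rw [← UnitAddCircle.norm_eq]
  exact (AddCircle.norm_coe_eq_abs_iff (1:ℝ) one_ne_zero).2 (by simpa using h)

lemma gK_small (r t : ℝ) (h : |t| ≤ 1/2) : gK r t = if |t| ≤ r then 1 else 0 := by
  unfold gK; rw [abs_round_half t h]

lemma pdist_eq (u v : ℝ) (hu : u ∈ Set.Icc (0:ℝ) 1) (hv : v ∈ Set.Icc (0:ℝ) 1) :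
    pdist u v = |(u - v) - round (u - v)| := by
  obtain ⟨h1, h2⟩ := hu
  obtain ⟨h3, h4⟩ := hv
  have key : ∀ t : ℝ, 0 ≤ t → t ≤ 1 → min |t| (1 - |t|) = |t - round t| := by
    intro t h0 h1
    rw [abs_of_nonneg h0, abs_sub_round_eq_min]
    rcases h1.lt_or_eq with h | h
    · rw [Int.fract_eq_self.2 ⟨h0, h⟩]
    · subst h; simp
  unfold pdist
  rcases le_total v u with h | h
  · exact key _ (by linarith) (by linarith)
  · have := key (v - u) (by linarith) (by linarith)
    rw [abs_sub_comm u v, this, ← UnitAddCircle.norm_eq, ← UnitAddCircle.norm_eq, ← norm_neg]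
    rw [← AddCircle.coe_neg, neg_sub]

lemma gK_meas (r : ℝ) : Measurable (gK r) := by
  unfold gK
  refine Measurable.ite ?_ measurable_const measurable_const
  have : (fun t : ℝ => |t - round t|) = fun t => min (Int.fract t) (1 - Int.fract t) := by
    funext t; exact abs_sub_round_eq_min t
  have h : Measurable (fun t : ℝ => |t - round t|) := by
    rw [this]; exact measurable_fract.min (measurable_const.sub measurable_fract)
  exact measurableSet_le h measurable_const

lemma gK_bound (r t : ℝ) : |gK r t| ≤ 1 := by
  unfold gK; split_ifs <;> simp

lemma inner_s (a b t : ℝ) (ha : 0 ≤ a) (hb : 0 ≤ b) (ha4 : a ≤ 1/4) (ht : |t| ≤ a) :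
    ∫ s in (-1/2:ℝ)..(1/2), gK b (t - s) * gK a s = min a (t + b) - max (-a) (t - b) := by
  rw [abs_le] at ht
  have h1 : ∀ s ∈ Set.uIoc (-1/2:ℝ) (1/2), gK b (t - s) * gK a s =
      (Set.Icc (max (-a) (t - b)) (min a (t + b))).indicator (fun _ => (1:ℝ)) s := by
    intro s hs
    rw [Set.uIoc_of_le (by norm_num)] at hs
    rw [gK_small a s (abs_le.2 ⟨by linarith [hs.1], hs.2⟩)]
    by_cases h : |s| ≤ a
    · have h' := abs_le.1 h
      rw [gK_small b (t - s) (abs_le.2 ⟨by linarith, by linarith⟩)]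
      simp only [Set.indicator, Set.mem_Icc, max_le_iff, le_min_iff, h, abs_le]
      simp only [if_true, mul_one]
      congr 1
      apply propext
      constructor
      · rintro ⟨_, _⟩; refine ⟨⟨?_, ?_⟩, ?_, ?_⟩ <;> linarith
      · rintro ⟨⟨_, _⟩, _, _⟩; constructor <;> linarith
    · rw [if_neg h, mul_zero, Set.indicator_of_notMem]
      rintro hh
      simp only [Set.mem_Icc, max_le_iff, le_min_iff] at hh
      exact h (abs_le.2 ⟨hh.1.1, hh.2.1⟩)
  rw [intervalIntegral.integral_congr_ae (Filter.Eventually.of_forall h1),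
    intervalIntegral.integral_of_le (by norm_num),
    integral_indicator measurableSet_Icc, Measure.restrict_restrict measurableSet_Icc,
    Set.inter_eq_left.2]
  · simp only [integral_const, smul_eq_mul, mul_one, measureReal_restrict_apply_univ,
      Real.volume_real_Icc]
    refine max_eq_left (sub_nonneg.2 (max_le (le_min ?_ ?_) (le_min ?_ ?_))) <;> linarith
  · intro s hs
    simp only [Set.mem_Icc, max_le_iff, le_min_iff] at hs
    exact ⟨by linarith [hs.1.1], by linarith [hs.2.1]⟩

lemma outer_t (a : ℝ) (L : ℝ → ℝ) (ha : 0 ≤ a) (ha4 : a ≤ 1/4) :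
    ∫ t in (-1/2:ℝ)..(1/2), gK a t * L t = ∫ t in (-a)..a, L t := by
  have h1 : ∀ s ∈ Set.uIoc (-1/2:ℝ) (1/2), gK a s * L s =
      (Set.Icc (-a) a).indicator L s := by
    intro s hs
    rw [Set.uIoc_of_le (by norm_num)] at hs
    rw [gK_small a s (abs_le.2 ⟨by linarith [hs.1], hs.2⟩)]
    simp only [Set.indicator, Set.mem_Icc, abs_le, ite_mul, one_mul, zero_mul]
  rw [intervalIntegral.integral_congr_ae (Filter.Eventually.of_forall h1),
    intervalIntegral.integral_of_le (by norm_num),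
    integral_indicator measurableSet_Icc, Measure.restrict_restrict measurableSet_Icc,
    Set.inter_eq_left.2, integral_Icc_eq_integral_Ioc, intervalIntegral.integral_of_le (by linarith)]
  intro s hs
  exact ⟨by linarith [hs.1], by linarith [hs.2]⟩

lemma shift (f : ℝ → ℝ) (hf : ∀ t, f (t + 1) = f t) (x : ℝ) :
    ∫ y in (0:ℝ)..1, f y = ∫ t in (-1/2:ℝ)..(1/2), f (t + x) := by
  have hp : Function.Periodic f 1 := hf
  have h := hp.intervalIntegral_add_eq 0 (-1/2 + x)
  rw [zero_add] at h
  rw [h, intervalIntegral.integral_comp_add_right]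
  congr 1; ring

lemma inner_all (a b x : ℝ) (ha : 0 ≤ a) (hb : 0 ≤ b) (ha4 : a ≤ 1/4) :
    ∫ y in (0:ℝ)..1, ∫ z in (0:ℝ)..1, gK a (x - y) * gK b (y - z) * gK a (z - x)
      = ∫ t in (-a)..a, (min a (t + b) - max (-a) (t - b)) := by
  have hz : ∀ y, ∫ z in (0:ℝ)..1, gK a (x - y) * gK b (y - z) * gK a (z - x)
      = gK a (x - y) * ∫ s in (-1/2:ℝ)..(1/2), gK b ((y - x) - s) * gK a s := by
    intro y
    rw [← intervalIntegral.integral_const_mul, shift _ _ x]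
    · congr 1; funext s; rw [mul_assoc]; congr 3 <;> ring
    · intro t
      rw [show t + 1 - x = (t - x) + 1 by ring, gK_add_one, ← gK_add_one b (y - (t+1))]
      congr 3; ring
  simp_rw [hz]
  rw [shift _ _ x]
  · have : ∀ t : ℝ, gK a (x - (t + x)) * (∫ s in (-1/2:ℝ)..(1/2), gK b ((t + x - x) - s) * gK a s)
      = gK a t * (∫ s in (-1/2:ℝ)..(1/2), gK b (t - s) * gK a s) := by
      intro t
      rw [show x - (t + x) = -t by ring, gK_neg, add_sub_cancel_right]
    simp_rw [this]
    rw [outer_t a _ ha ha4]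
    apply intervalIntegral.integral_congr
    intro t ht
    rw [Set.uIcc_of_le (by linarith)] at ht
    exact inner_s a b t ha hb ha4 (abs_le.2 ht)
  · intro t
    rw [← gK_add_one a (x - (t+1))]
    congr 1
    · congr 1; ring
    · congr 1; funext s
      rw [show t + 1 - x - s = (t - x - s) + 1 by ring, gK_add_one]

lemma L_same (a : ℝ) (ha : 0 ≤ a) :
    ∫ t in (-a)..a, (min a (t + a) - max (-a) (t - a)) = 3 * a ^ 2 := by
  have hc : Continuous fun t : ℝ => (min a (t + a) - max (-a) (t - a)) := by fun_prop
  rw [← intervalIntegral.integral_add_adjacent_intervals (b := 0) (hc.intervalIntegrable _ _)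
    (hc.intervalIntegrable _ _)]
  have h1 : ∫ t in (-a)..0, (min a (t + a) - max (-a) (t - a)) = ∫ t in (-a)..0, (t + 2 * a) := by
    apply intervalIntegral.integral_congr
    intro t ht
    rw [Set.uIcc_of_le (by linarith)] at ht
    simp only
    rw [min_eq_right (by linarith [ht.2]), max_eq_left (by linarith [ht.2])]; ring
  have h2 : ∫ t in (0)..a, (min a (t + a) - max (-a) (t - a)) = ∫ t in (0)..a, (2 * a - t) := by
    apply intervalIntegral.integral_congr
    intro t ht
    rw [Set.uIcc_of_le (by linarith)] at ht
    simp only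
    rw [min_eq_left (by linarith [ht.1]), max_eq_right (by linarith [ht.1])]; ring
  rw [h1, h2, intervalIntegral.integral_add (by simp) (by simp),
    intervalIntegral.integral_sub (by simp) (by simp)]
  simp
  ring

lemma L_mixed (a b : ℝ) (ha : 0 ≤ a) (hb : 2 * a ≤ b) :
    ∫ t in (-a)..a, (min a (t + b) - max (-a) (t - b)) = 4 * a ^ 2 := by
  have h1 : ∫ t in (-a)..a, (min a (t + b) - max (-a) (t - b)) = ∫ t in (-a)..a, (2 * a) := by
    apply intervalIntegral.integral_congr
    intro t ht
    rw [Set.uIcc_of_le (by linarith)] at ht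
    simp only
    rw [min_eq_left (by linarith [ht.1]), max_eq_left (by linarith [ht.2])]; ring
  rw [h1]; simp; ring

abbrev uI : Measure ℝ := volume.restrict (Set.Icc (0 : ℝ) 1)

instance : IsProbabilityMeasure uI := ⟨by simp [uI]⟩

lemma triple_map (n : ℕ) (i j k : Fin n) (hij : i ≠ j) (hik : i ≠ k) (hjk : j ≠ k) :
    (gbmMeasure n).map (fun X => ((X j, X k), X i)) = (uI.prod uI).prod uI := by
  have hI : ProbabilityTheory.iIndepFun (fun (i : Fin n) (X : Fin n → ℝ) => X i) (gbmMeasure n) :=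
    ProbabilityTheory.iIndepFun_pi (μ := fun _ : Fin n => uI) (X := fun _ x => x)
      (fun _ => aemeasurable_id)
  have hm : ∀ i : Fin n, (gbmMeasure n).map (fun X => X i) = uI := fun i =>
    (measurePreserving_eval (fun _ : Fin n => uI) i).map_eq
  have : IsProbabilityMeasure (gbmMeasure n) := by unfold gbmMeasure; infer_instance
  have h1 := hI.indepFun_prodMk (fun i => measurable_pi_apply i) j k i hij.symm hik.symm
  have h2 := hI.indepFun hjk
  rw [ProbabilityTheory.indepFun_iff_map_prod_eq_prod_map_map
    (by exact Measurable.aemeasurable (by fun_prop))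
    (by exact Measurable.aemeasurable (by fun_prop))] at h1 h2
  rw [h1, h2, hm, hm, hm]

lemma triple_int (n : ℕ) (i j k : Fin n) (hij : i ≠ j) (hik : i ≠ k) (hjk : j ≠ k) (a b : ℝ)
    (ha : 0 ≤ a) (hb : 0 ≤ b) (ha4 : a ≤ 1/4) :
    ∫ X, gK a (X i - X j) * gK b (X j - X k) * gK a (X k - X i) ∂gbmMeasure n
      = ∫ t in (-a)..a, (min a (t + b) - max (-a) (t - b)) := by
  have hKa := gK_meas a
  have hKb := gK_meas b
  have hF : Measurable (fun q : (ℝ × ℝ) × ℝ =>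
    gK a (q.2 - q.1.1) * gK b (q.1.1 - q.1.2) * gK a (q.1.2 - q.2)) := by fun_prop
  have hbd : ∀ x y z : ℝ, ‖gK a x * gK b y * gK a z‖ ≤ 1 := by
    intro x y z
    rw [norm_mul, norm_mul]
    exact mul_le_one₀ (mul_le_one₀ (gK_bound _ _) (norm_nonneg _) (gK_bound _ _))
      (norm_nonneg _) (gK_bound _ _)
  have h := integral_map (μ := gbmMeasure n) (φ := fun X => ((X j, X k), X i))
    (by fun_prop) hF.aestronglyMeasurable
  simp only at h
  rw [← h, triple_map n i j k hij hik hjk, integral_prod_symm]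
  · have : ∀ x : ℝ, ∫ p : ℝ × ℝ, gK a (x - p.1) * gK b (p.1 - p.2) * gK a (p.2 - x) ∂(uI.prod uI)
        = ∫ t in (-a)..a, (min a (t + b) - max (-a) (t - b)) := by
      intro x
      rw [← inner_all a b x ha hb ha4, integral_prod]
      · simp only [uI, integral_Icc_eq_integral_Ioc,
          intervalIntegral.integral_of_le (zero_le_one (α := ℝ))]
      · exact Integrable.of_bound (by fun_prop) 1 (Filter.Eventually.of_forall fun p => hbd _ _ _)
    simp only [this]
    simp
  · exact Integrable.of_bound (by fun_prop) 1 (Filter.Eventually.of_forall fun p => hbd _ _ _)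

lemma gbmA_eq (n m : ℕ) (rs rd : ℝ) (X : Fin n → ℝ) (hX : ∀ i, X i ∈ Set.Icc (0:ℝ) 1)
    (i j : Fin n) (hij : i ≠ j) :
    gbmA n m rs rd X i j = gK (if ((i : ℕ) < m ↔ (j : ℕ) < m) then rs else rd) (X i - X j) := by
  unfold gbmA gK
  rw [if_neg hij, pdist_eq _ _ (hX i) (hX j)]
  split_ifs <;> simp_all

lemma tri_val (n m : ℕ) (rs rd : ℝ)
    (hrd0 : 0 ≤ rd) (h2d : 2 * rd ≤ rs) (hs4 : rs ≤ 1 / 4)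
    (i j k : Fin n) (hij : i ≠ j) (hik : i ≠ k) (hjk : j ≠ k) :
    ∫ X, gbmA n m rs rd X i j * gbmA n m rs rd X j k * gbmA n m rs rd X k i ∂gbmMeasure n
    = if ((i : ℕ) < m ↔ (j : ℕ) < m) ∧ ((i : ℕ) < m ↔ (k : ℕ) < m) then 3 * rs ^ 2
      else 4 * rd ^ 2 := by
  have hX : ∀ᵐ X ∂gbmMeasure n, ∀ i, X i ∈ Set.Icc (0:ℝ) 1 := by
    rw [ae_all_iff]
    intro i
    have h := (measurePreserving_eval (fun _ : Fin n => uI) i).quasiMeasurePreserving.ae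
      (p := fun x => x ∈ Set.Icc (0:ℝ) 1) (ae_restrict_mem measurableSet_Icc)
    exact h
  have hrs : 0 ≤ rs := by linarith
  have hrd4 : rd ≤ 1/4 := by linarith
  have e : ∫ X, gbmA n m rs rd X i j * gbmA n m rs rd X j k * gbmA n m rs rd X k i ∂gbmMeasure n
     = ∫ X, gK (if ((i : ℕ) < m ↔ (j : ℕ) < m) then rs else rd) (X i - X j) *
        gK (if ((j : ℕ) < m ↔ (k : ℕ) < m) then rs else rd) (X j - X k) *
        gK (if ((k : ℕ) < m ↔ (i : ℕ) < m) then rs else rd) (X k - X i) ∂gbmMeasure n := by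
    apply integral_congr_ae
    filter_upwards [hX] with X hX
    rw [gbmA_eq n m rs rd X hX i j hij, gbmA_eq n m rs rd X hX j k hjk,
      gbmA_eq n m rs rd X hX k i hik.symm]
  rw [e]
  have hS := triple_int n i j k hij hik hjk rs rs hrs hrs hs4
  rw [L_same rs hrs] at hS
  have h1 := triple_int n i j k hij hik hjk rd rs hrd0 hrs hrd4
  have h2 := triple_int n j k i hjk hij.symm hik.symm rd rs hrd0 hrs hrd4
  have h3 := triple_int n k i j hik.symm hjk.symm hij rd rs hrd0 hrs hrd4
  rw [L_mixed rd rs hrd0 h2d] at h1 h2 h3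
  by_cases ci : (i : ℕ) < m <;> by_cases cj : (j : ℕ) < m <;> by_cases ck : (k : ℕ) < m <;>
    simp only [ci, cj, ck, iff_true, iff_false, true_iff, false_iff, not_true, not_false_eq_true,
      if_true, if_false, and_true, true_and, and_false, false_and] <;>
    first
    | exact hS
    | exact h1
    | (rw [← h2]; congr 1; funext X; ring1)
    | (rw [← h3]; congr 1; funext X; ring1)

lemma count (n : ℕ) (f : Fin n → ℝ) (hf : ∀ i, f i * f i = f i) :
    (∑ i : Fin n, ∑ j : Fin n, ∑ k : Fin n,
      if i ≠ j ∧ i ≠ k ∧ j ≠ k then f i * f j * f k else 0)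
      = (∑ i, f i) * ((∑ i, f i) - 1) * ((∑ i, f i) - 2) := by
  set S := ∑ i, f i with hS
  have hk : ∀ i j : Fin n, (∑ k : Fin n,
      if i ≠ j ∧ i ≠ k ∧ j ≠ k then f i * f j * f k else 0)
      = f i * f j * (S - 2) - (if i = j then f i * (S - 2) else 0) := by
    intro i j
    by_cases h : i = j
    · subst h; simp; rw [hf]; ring
    · have : ∀ k, (if i ≠ j ∧ i ≠ k ∧ j ≠ k then f i * f j * f k else 0)
          = f i * f j * f k - (if i = k then f i * f j * f k else 0)
            - (if j = k then f i * f j * f k else 0) := by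
        intro k
        by_cases h1 : i = k
        · subst h1; simp [h, Ne.symm h]
        · by_cases h2 : j = k <;> simp [h, h1, h2]
      simp_rw [this]
      rw [Finset.sum_sub_distrib, Finset.sum_sub_distrib, ← Finset.mul_sum]
      simp [h]
      linear_combination (-f j) * hf i - f i * hf j
  simp_rw [hk, Finset.sum_sub_distrib]
  simp only [Finset.sum_ite_eq, Finset.mem_univ, if_true]
  rw [← Finset.sum_mul, ← hS]
  simp_rw [← Finset.sum_mul, ← Finset.mul_sum]
  rw [← Finset.sum_mul, ← hS]
  ring

theorem expected_triangles_large_rs (n : ℕ) (τ : ℝ) (hτ : τ ∈ Set.Icc (0 : ℝ) 1)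
    (m : ℕ) (hm : (m : ℝ) = τ * n) (rs rd : ℝ)
    (hrd0 : 0 ≤ rd) (h2d : 2 * rd ≤ rs) (hs4 : rs ≤ 1 / 4) :
    (∑ i : Fin n, ∑ j : Fin n, ∑ k : Fin n,
        if i ≠ j ∧ i ≠ k ∧ j ≠ k then
          ∫ X, gbmA n m rs rd X i j * gbmA n m rs rd X j k * gbmA n m rs rd X k i
            ∂gbmMeasure n
        else 0)
    = 3 * rs ^ 2 * ((m : ℝ) * ((m : ℝ) - 1) * ((m : ℝ) - 2)
          + ((n : ℝ) - m) * ((n : ℝ) - m - 1) * ((n : ℝ) - m - 2))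
      + 12 * rd ^ 2 * ((m : ℝ) * ((m : ℝ) - 1) * ((n : ℝ) - m)
          + (m : ℝ) * ((n : ℝ) - m) * ((n : ℝ) - m - 1)) := by
  have hmn : m ≤ n := by
    have : (m : ℝ) ≤ n := by
      rw [hm]; exact mul_le_of_le_one_left (Nat.cast_nonneg n) hτ.2
    exact_mod_cast this
  let p : Fin n → ℝ := fun i => if (i : ℕ) < m then 1 else 0
  have hp : ∑ i, p i = m := by
    simp only [p, Finset.sum_boole]
    rw [Fin.card_filter_val_lt]
    simp [hmn]
  have hq : ∑ i, (1 - p i) = n - m := by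
    rw [Finset.sum_sub_distrib, hp]; simp
  have hc1 := count n (fun _ => 1) (by simp)
  have hc2 := count n p (by intro i; simp only [p]; split_ifs <;> simp)
  have hc3 := count n (fun i => 1 - p i) (by intro i; simp only [p]; split_ifs <;> simp)
  rw [hp] at hc2
  simp only [hq] at hc3
  simp only [Finset.sum_const, Finset.card_univ, Fintype.card_fin, nsmul_eq_mul, mul_one] at hc1
  have key : ∀ i j k : Fin n, (if i ≠ j ∧ i ≠ k ∧ j ≠ k then
          ∫ X, gbmA n m rs rd X i j * gbmA n m rs rd X j k * gbmA n m rs rd X k i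
            ∂gbmMeasure n
        else 0) = 4 * rd ^ 2 * (if i ≠ j ∧ i ≠ k ∧ j ≠ k then 1 else 0)
        + (3 * rs ^ 2 - 4 * rd ^ 2) * (if i ≠ j ∧ i ≠ k ∧ j ≠ k then p i * p j * p k else 0)
        + (3 * rs ^ 2 - 4 * rd ^ 2) *
          (if i ≠ j ∧ i ≠ k ∧ j ≠ k then (1 - p i) * (1 - p j) * (1 - p k) else 0) := by
    intro i j k
    by_cases h : i ≠ j ∧ i ≠ k ∧ j ≠ k
    · simp only [if_pos h]
      rw [tri_val n m rs rd hrd0 h2d hs4 i j k h.1 h.2.1 h.2.2]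
      simp only [p]
      by_cases ci : (i : ℕ) < m <;> by_cases cj : (j : ℕ) < m <;> by_cases ck : (k : ℕ) < m <;>
        simp [ci, cj, ck]
    · simp only [if_neg h]; ring
  simp_rw [key, Finset.sum_add_distrib, ← Finset.mul_sum]
  rw [hc2, hc3]
  have hc1' : (∑ i : Fin n, ∑ j : Fin n, ∑ k : Fin n,
      if i ≠ j ∧ i ≠ k ∧ j ≠ k then (1:ℝ) else 0) = n * (n - 1) * (n - 2) := hc1
  rw [hc1']
  ring
end
end

section
/- There exists an absolute constant C > 0 such that for every geometric block model G_n(r_s, r_d) with 0 ≤ r_d ≤ r_s ≤ 1/4, the centered number of ordered triangles T_n = Σ_{i≠j≠k} (A_ij A_jk A_ki − E[A_ij A_jk A_ki]) (sum over ordered triples of pairwise distinct vertices) satisfies E[T_n²] ≤ C·(n⁴ r_s³ + n³ r_s²). -/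
open MeasureTheory Finset

noncomputable section

namespace GBM

instance instProbCircle : IsProbabilityMeasure (volume : Measure UnitAddCircle) :=
  ⟨UnitAddCircle.measure_univ⟩

/-- Measurable functions with values in `[0,1]`. -/
structure Nice {α : Type*} [MeasurableSpace α] (A : α → ℝ) : Prop where
  meas : Measurable A
  nonneg : ∀ x, 0 ≤ A x
  le_one : ∀ x, A x ≤ 1

lemma Nice.integrable {α : Type*} [MeasurableSpace α] {A : α → ℝ} (h : Nice A)
    (μ : Measure α) [IsFiniteMeasure μ] : Integrable A μ :=
  Integrable.of_bound h.meas.aestronglyMeasurable 1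
    (Filter.Eventually.of_forall fun x => by
      rw [Real.norm_eq_abs, abs_of_nonneg (h.nonneg x)]; exact h.le_one x)

lemma Nice.mul {α : Type*} [MeasurableSpace α] {A B : α → ℝ} (hA : Nice A) (hB : Nice B) :
    Nice (fun x => A x * B x) :=
  ⟨hA.meas.mul hB.meas, fun x => mul_nonneg (hA.nonneg x) (hB.nonneg x),
    fun x => mul_le_one₀ (hA.le_one x) (hB.nonneg x) (hB.le_one x)⟩

lemma Nice.comp {α β : Type*} [MeasurableSpace α] [MeasurableSpace β] {A : α → ℝ} (hA : Nice A)
    {f : β → α} (hf : Measurable f) : Nice (fun x => A (f x)) :=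
  ⟨hA.meas.comp hf, fun _ => hA.nonneg _, fun _ => hA.le_one _⟩

lemma nice_one {α : Type*} [MeasurableSpace α] : Nice (fun _ : α => (1 : ℝ)) :=
  ⟨measurable_const, fun _ => zero_le_one, fun _ => le_rfl⟩

/-- extension by zero -/
def ext0 {n : ℕ} (p : Fin n → Prop) [DecidablePred p] (u : {l // p l} → UnitAddCircle) :
    Fin n → UnitAddCircle := fun l => if h : p l then u ⟨l, h⟩ else 0

lemma measurable_ext0 {n : ℕ} (p : Fin n → Prop) [DecidablePred p] : Measurable (ext0 p) := by
  refine measurable_pi_lambda _ fun l => ?_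
  unfold ext0
  by_cases h : p l
  · simp only [h, dif_pos]; exact measurable_pi_apply _
  · simp only [h]; exact measurable_const

lemma key0 {n : ℕ} (p : Fin n → Prop) [DecidablePred p] (i : Fin n) (hi : ¬ p i)
    {A B : (Fin n → UnitAddCircle) → ℝ} (hA : Nice A) (hB : Nice B)
    (hAinv : ∀ X Y : Fin n → UnitAddCircle, (∀ l, p l → X l - X i = Y l - Y i) → A X = A Y)
    (hBinv : ∀ X Y : Fin n → UnitAddCircle, (∀ l, ¬ p l → X l = Y l) → B X = B Y) :
    ∫ X, A X * B X = (∫ u, A (ext0 p u)) * ∫ v, B (ext0 (fun l => ¬ p l) v) := by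
  have hA0 : Nice (fun u => A (ext0 p u)) := hA.comp (measurable_ext0 p)
  have hB0 : Nice (fun v => B (ext0 (fun l => ¬ p l) v)) := hB.comp (measurable_ext0 _)
  have hmp := volume_preserving_piEquivPiSubtypeProd (fun _ : Fin n => UnitAddCircle) p
  set G : ({l // p l} → UnitAddCircle) × ({l // ¬ p l} → UnitAddCircle) → ℝ :=
    fun z => A (ext0 p (fun l => z.1 l - z.2 ⟨i, hi⟩)) * B (ext0 (fun l => ¬ p l) z.2) with hG
  have hGn : Nice G := by
    refine Nice.mul (hA0.comp (f := fun z : ({l // p l} → UnitAddCircle) ×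
      ({l // ¬ p l} → UnitAddCircle) => fun l => z.1 l - z.2 ⟨i, hi⟩) ?_) (hB0.comp measurable_snd)
    refine measurable_pi_lambda _ fun l => ?_
    exact ((measurable_pi_apply l).comp measurable_fst).sub
      ((measurable_pi_apply _).comp measurable_snd)
  have h1 : ∫ X, A X * B X = ∫ z, G z := by
    rw [← hmp.integral_comp (MeasurableEquiv.measurableEmbedding _)]
    refine integral_congr_ae (Filter.Eventually.of_forall fun X => ?_)
    simp only [hG]
    congr 1
    · apply hAinv
      intro l hl
      simp [ext0, hl, hi, MeasurableEquiv.piEquivPiSubtypeProd, Equiv.piEquivPiSubtypeProd]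
    · apply hBinv
      intro l hl
      simp [ext0, hl, MeasurableEquiv.piEquivPiSubtypeProd, Equiv.piEquivPiSubtypeProd]
  rw [h1, Measure.volume_eq_prod, integral_prod_symm _ (hGn.integrable _)]
  simp only [hG]
  simp_rw [integral_mul_const]
  have h2 : ∀ v : {l // ¬ p l} → UnitAddCircle,
      ∫ u : {l // p l} → UnitAddCircle, A (ext0 p (fun l => u l - v ⟨i, hi⟩)) = ∫ u, A (ext0 p u) := fun v =>
    integral_sub_right_eq_self (fun u => A (ext0 p u)) (fun _ => v ⟨i, hi⟩)
  simp_rw [h2]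
  rw [integral_const_mul]

lemma key {n : ℕ} (p : Fin n → Prop) [DecidablePred p] (i : Fin n) (hi : ¬ p i)
    {A B : (Fin n → UnitAddCircle) → ℝ} (hA : Nice A) (hB : Nice B)
    (hAinv : ∀ X Y : Fin n → UnitAddCircle, (∀ l, p l → X l - X i = Y l - Y i) → A X = A Y)
    (hBinv : ∀ X Y : Fin n → UnitAddCircle, (∀ l, ¬ p l → X l = Y l) → B X = B Y) :
    ∫ X, A X * B X = (∫ X, A X) * ∫ X, B X := by
  have h1 := key0 p i hi hA hB hAinv hBinv
  have h2 := key0 p i hi hA nice_one hAinv (fun _ _ _ => rfl)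
  have h3 := key0 p i hi nice_one hB (fun _ _ _ => rfl) hBinv
  simp only [mul_one, one_mul, integral_const, probReal_univ, smul_eq_mul] at h2 h3
  rw [h1, h2, h3]

/-- edge indicator -/
def e (r : ℝ) (x y : UnitAddCircle) : ℝ := if ‖x - y‖ ≤ r then 1 else 0

lemma e_comm (r : ℝ) (x y : UnitAddCircle) : e r x y = e r y x := by
  unfold e; rw [norm_sub_rev]

lemma e_mono {r s : ℝ} (h : r ≤ s) (x y : UnitAddCircle) : e r x y ≤ e s x y := by
  unfold e; split_ifs <;> linarith

lemma e_nonneg (r : ℝ) (x y : UnitAddCircle) : 0 ≤ e r x y := by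
  unfold e; split_ifs <;> norm_num

lemma e_le_one (r : ℝ) (x y : UnitAddCircle) : e r x y ≤ 1 := by
  unfold e; split_ifs <;> norm_num

lemma e_nice {α : Type*} [MeasurableSpace α] (r : ℝ) {f g : α → UnitAddCircle}
    (hf : Measurable f) (hg : Measurable g) : Nice (fun x => e r (f x) (g x)) := by
  refine ⟨?_, fun _ => e_nonneg _ _ _, fun _ => e_le_one _ _ _⟩
  unfold e
  exact Measurable.ite (measurableSet_le (hf.sub hg).norm measurable_const)
    measurable_const measurable_const

lemma e_niceX {n : ℕ} (r : ℝ) (i j : Fin n) :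
    Nice (fun X : Fin n → UnitAddCircle => e r (X i) (X j)) :=
  e_nice r (measurable_pi_apply i) (measurable_pi_apply j)

lemma eval_int {n : ℕ} (r : ℝ) (p : Fin n → Prop) [DecidablePred p] (s : {l // p l}) :
    ∫ u : {l // p l} → UnitAddCircle, e r (u s) 0 = ∫ x : UnitAddCircle, e r x 0 := by
  have hmp := measurePreserving_eval
    (fun _ : {l : Fin n // p l} => (volume : Measure UnitAddCircle)) s
  have hn : Nice (fun x : UnitAddCircle => e r x 0) := e_nice r measurable_id measurable_const
  rw [← hmp.map_eq, integral_map hmp.measurable.aemeasurable hn.meas.aestronglyMeasurable]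
  rfl

lemma edge_step {n : ℕ} {r : ℝ} (hr : 0 ≤ r) (a b : Fin n) (hab : a ≠ b)
    {B : (Fin n → UnitAddCircle) → ℝ} (hB : Nice B)
    (hBinv : ∀ X Y : Fin n → UnitAddCircle, (∀ l, l ≠ a → X l = Y l) → B X = B Y) :
    ∫ X, e r (X a) (X b) * B X ≤ 2 * r * ∫ X, B X := by
  have hinv : ∀ X Y : Fin n → UnitAddCircle, (∀ l, l = a → X l - X b = Y l - Y b) →
      e r (X a) (X b) = e r (Y a) (Y b) := by
    intro X Y h
    unfold e; rw [h a rfl]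
  rw [key (fun l => l = a) b hab.symm (e_niceX r a b) hB hinv hBinv]
  refine mul_le_mul_of_nonneg_right ?_ (integral_nonneg hB.nonneg)
  have h2 := key0 (fun l => l = a) b hab.symm (e_niceX r a b) nice_one hinv (fun _ _ _ => rfl)
  simp only [mul_one, integral_const, probReal_univ, smul_eq_mul] at h2
  rw [h2]
  have h3 : ∀ u : {l // l = a} → UnitAddCircle,
      e r (ext0 (fun l => l = a) u a) (ext0 (fun l => l = a) u b) = e r (u ⟨a, rfl⟩) 0 := by
    intro u; simp [ext0, hab.symm]
  simp_rw [h3]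
  refine le_of_eq_of_le (eval_int r (fun l => l = a) ⟨a, rfl⟩) ?_
  have h5 : (fun x : UnitAddCircle => e r x 0)
      = (Metric.closedBall (0 : UnitAddCircle) r).indicator (fun _ => (1 : ℝ)) := by
    funext x
    simp [e, Set.indicator, Metric.mem_closedBall, dist_zero_right]
  rw [h5, integral_indicator Metric.isClosed_closedBall.measurableSet]
  simp only [integral_const, smul_eq_mul, mul_one, measureReal_restrict_apply_univ]
  rw [Measure.real, AddCircle.volume_closedBall, ENNReal.toReal_ofReal]
  · exact min_le_right _ _
  · exact le_min zero_le_one (by linarith)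

/-- triangle indicator -/
def T {n : ℕ} (R : Fin n → Fin n → ℝ) (i j k : Fin n) (X : Fin n → UnitAddCircle) : ℝ :=
  e (R i j) (X i) (X j) * e (R j k) (X j) (X k) * e (R k i) (X k) (X i)

lemma T_nice {n : ℕ} (R : Fin n → Fin n → ℝ) (i j k : Fin n) : Nice (T R i j k) :=
  ((e_niceX _ _ _).mul (e_niceX _ _ _)).mul (e_niceX _ _ _)

lemma T_rot {n : ℕ} (R : Fin n → Fin n → ℝ) (i j k : Fin n) : T R i j k = T R j k i := by
  funext X; unfold T; ring

lemma T_le_edge {n : ℕ} {R : Fin n → Fin n → ℝ} {r : ℝ} (hR : ∀ i j, R i j ≤ r) (i j k : Fin n)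
    (X : Fin n → UnitAddCircle) : T R i j k X ≤ e r (X i) (X j) := by
  unfold T
  refine le_trans ?_ (e_mono (hR i j) _ _)
  rw [mul_assoc]
  exact mul_le_of_le_one_right (e_nonneg _ _ _)
    (mul_le_one₀ (e_le_one _ _ _) (e_nonneg _ _ _) (e_le_one _ _ _))

lemma T_le_two {n : ℕ} {R : Fin n → Fin n → ℝ} {r : ℝ} (hR : ∀ i j, R i j ≤ r) (i j k : Fin n)
    (X : Fin n → UnitAddCircle) : T R i j k X ≤ e r (X i) (X j) * e r (X k) (X j) := by
  unfold T
  rw [e_comm r (X k)]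
  refine le_trans (mul_le_of_le_one_right (mul_nonneg (e_nonneg _ _ _) (e_nonneg _ _ _))
    (e_le_one _ _ _)) ?_
  exact mul_le_mul (e_mono (hR _ _) _ _) (e_mono (hR _ _) _ _) (e_nonneg _ _ _) (e_nonneg _ _ _)

lemma two_bound {n : ℕ} {r : ℝ} (hr : 0 ≤ r) {i j k : Fin n} (hij : i ≠ j) (hik : i ≠ k)
    (hjk : j ≠ k) :
    ∫ X : Fin n → UnitAddCircle, e r (X i) (X j) * e r (X k) (X j) ≤ 4 * r ^ 2 := by
  refine (edge_step hr i j hij (e_niceX r k j) ?_).trans ?_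
  · intro X Y h; simp only [h k hik.symm, h j hij.symm]
  · have := edge_step hr k j hjk.symm (nice_one (α := Fin n → UnitAddCircle)) (fun _ _ _ => rfl)
    simp only [mul_one, integral_const, probReal_univ, smul_eq_mul] at this
    nlinarith

lemma three_bound {n : ℕ} {r : ℝ} (hr : 0 ≤ r) {i j k a c : Fin n} (hij : i ≠ j) (hik : i ≠ k)
    (hjk : j ≠ k) (hca : c ≠ a) (hci : c ≠ i) (hcj : c ≠ j) (hck : c ≠ k) :
    ∫ X : Fin n → UnitAddCircle, e r (X c) (X a) * (e r (X i) (X j) * e r (X k) (X j))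
      ≤ 8 * r ^ 3 := by
  refine (edge_step hr c a hca ((e_niceX r i j).mul (e_niceX r k j)) ?_).trans ?_
  · intro X Y h; simp only [h k hck.symm, h j hcj.symm, h i hci.symm]
  · have := two_bound hr hij hik hjk
    nlinarith

/-- one new vertex `c` -/
lemma TT_three {n : ℕ} {R : Fin n → Fin n → ℝ} {r : ℝ} (hr : 0 ≤ r) (hR : ∀ i j, R i j ≤ r)
    {i j k a b c : Fin n} (hij : i ≠ j) (hik : i ≠ k)
    (hjk : j ≠ k) (hca : c ≠ a) (hci : c ≠ i) (hcj : c ≠ j) (hck : c ≠ k) :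
    ∫ X, T R c a b X * T R i j k X ≤ 8 * r ^ 3 := by
  refine le_trans (integral_mono (((T_nice R c a b).mul (T_nice R i j k)).integrable _)
    (((e_niceX r c a).mul ((e_niceX r i j).mul (e_niceX r k j))).integrable _) fun X => ?_)
    (three_bound hr hij hik hjk hca hci hcj hck)
  exact mul_le_mul (T_le_edge hR _ _ _ _) (T_le_two hR _ _ _ _) ((T_nice _ _ _ _).nonneg _)
    (e_nonneg _ _ _)

lemma TT_two {n : ℕ} {R : Fin n → Fin n → ℝ} {r : ℝ} (hr : 0 ≤ r) (hR : ∀ i j, R i j ≤ r)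
    {i j k a b c : Fin n} (hij : i ≠ j) (hik : i ≠ k) (hjk : j ≠ k) :
    ∫ X, T R a b c X * T R i j k X ≤ 4 * r ^ 2 := by
  refine le_trans (integral_mono (((T_nice R a b c).mul (T_nice R i j k)).integrable _)
    (((e_niceX r i j).mul (e_niceX r k j)).integrable _) fun X => ?_)
    (two_bound hr hij hik hjk)
  exact (mul_le_of_le_one_left ((T_nice _ _ _ _).nonneg _) ((T_nice _ _ _ _).le_one _)).trans
    (T_le_two hR _ _ _ _)

/-- two new vertices `b, c` -/
lemma TT_zero {n : ℕ} (R : Fin n → Fin n → ℝ) {i j k a b c : Fin n} (hab : a ≠ b) (hac : a ≠ c)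
    (hbi : b ≠ i) (hbj : b ≠ j) (hbk : b ≠ k) (hci : c ≠ i) (hcj : c ≠ j) (hck : c ≠ k) :
    ∫ X, T R a b c X * T R i j k X = (∫ X, T R a b c X) * ∫ X, T R i j k X := by
  refine key (fun l => l = b ∨ l = c) a (by tauto) (T_nice _ _ _ _) (T_nice _ _ _ _) ?_ ?_
  · intro X Y h
    have hb := h b (Or.inl rfl)
    have hc := h c (Or.inr rfl)
    have h1 : X a - X b = Y a - Y b := by rw [← neg_sub, hb, neg_sub]
    have h2 : X b - X c = Y b - Y c := by
      rw [← sub_sub_sub_cancel_right _ _ (X a), hb, hc, sub_sub_sub_cancel_right]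
    simp only [T, e, h1, h2, hc]
  · intro X Y h
    simp only [T, h i (by tauto), h j (by tauto), h k (by tauto)]

/-- centered triangle -/
def F {n : ℕ} (R : Fin n → Fin n → ℝ) (i j k : Fin n) (X : Fin n → UnitAddCircle) : ℝ :=
  if i ≠ j ∧ i ≠ k ∧ j ≠ k then T R i j k X - ∫ Y, T R i j k Y else 0

lemma F_meas {n : ℕ} (R : Fin n → Fin n → ℝ) (i j k : Fin n) : Measurable (F R i j k) := by
  unfold F
  split_ifs
  · exact (T_nice _ _ _ _).meas.sub measurable_const
  · exact measurable_const

lemma F_bdd {n : ℕ} (R : Fin n → Fin n → ℝ) (i j k : Fin n) (X) : ‖F R i j k X‖ ≤ 1 := by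
  have h0 := (T_nice R i j k).nonneg X
  have h1 := (T_nice R i j k).le_one X
  have h2 : 0 ≤ ∫ Y, T R i j k Y := integral_nonneg (T_nice R i j k).nonneg
  have h3 : ∫ Y, T R i j k Y ≤ 1 := by
    have := integral_mono ((T_nice R i j k).integrable volume) (nice_one.integrable _)
      (T_nice R i j k).le_one
    simpa using this
  unfold F
  rw [Real.norm_eq_abs, abs_le]
  split_ifs <;> constructor <;> linarith

lemma FF_int {n : ℕ} (R : Fin n → Fin n → ℝ) (i j k a b c : Fin n) :
    Integrable (fun X => F R a b c X * F R i j k X) := by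
  refine Integrable.of_bound ((F_meas _ _ _ _).mul (F_meas _ _ _ _)).aestronglyMeasurable 1
    (Filter.Eventually.of_forall fun X => ?_)
  rw [norm_mul]
  exact mul_le_one₀ (F_bdd _ _ _ _ _) (norm_nonneg _) (F_bdd _ _ _ _ _)

lemma FF_cov {n : ℕ} (R : Fin n → Fin n → ℝ) {i j k a b c : Fin n}
    (h : i ≠ j ∧ i ≠ k ∧ j ≠ k) (h' : a ≠ b ∧ a ≠ c ∧ b ≠ c) :
    ∫ X, F R a b c X * F R i j k X =
      (∫ X, T R a b c X * T R i j k X) - (∫ X, T R a b c X) * ∫ X, T R i j k X := by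
  simp only [F, if_pos h, if_pos h']
  set p := ∫ X, T R a b c X with hp
  set q := ∫ X, T R i j k X with hq
  have e1 : ∀ X, (T R a b c X - p) * (T R i j k X - q)
      = (T R a b c X * T R i j k X - p * T R i j k X) - (T R a b c X * q - p * q) := fun X => by ring
  have i1 := (T_nice R a b c).integrable volume
  have i2 := (T_nice R i j k).integrable volume
  have i3 := ((T_nice R a b c).mul (T_nice R i j k)).integrable volume
  simp_rw [e1]
  have j1 : Integrable (fun X => T R a b c X * T R i j k X - p * T R i j k X) :=
    i3.sub (i2.const_mul p)
  have j2 : Integrable (fun X => T R a b c X * q - p * q) :=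
    (i1.mul_const q).sub (integrable_const _)
  rw [integral_sub j1 j2,
    integral_sub i3 (i2.const_mul p), integral_sub (i1.mul_const q) (integrable_const _),
    integral_const_mul, integral_mul_const, ← hp, ← hq]
  simp

/-- membership indicator -/
def ind {n : ℕ} (s : Finset (Fin n)) (a : Fin n) : ℝ := if a ∈ s then 1 else 0

lemma ind_nonneg {n : ℕ} (s : Finset (Fin n)) (a : Fin n) : 0 ≤ ind s a := by
  unfold ind; split_ifs <;> norm_num

lemma sum_ind {n : ℕ} (i j k : Fin n) : ∑ a, ind {i, j, k} a ≤ 3 := by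
  simp only [ind, Finset.sum_ite_mem, Finset.univ_inter, Finset.sum_const, nsmul_eq_mul, mul_one]
  exact_mod_cast Finset.card_le_three

lemma FF_bound {n : ℕ} {R : Fin n → Fin n → ℝ} {r : ℝ} (hr : 0 ≤ r) (hR : ∀ i j, R i j ≤ r)
    (i j k a b c : Fin n) :
    ∫ X, F R a b c X * F R i j k X ≤
      8 * r ^ 3 * (ind {i, j, k} a * ind {i, j, k} b + ind {i, j, k} a * ind {i, j, k} c
        + ind {i, j, k} b * ind {i, j, k} c)
      + 4 * r ^ 2 * (ind {i, j, k} a * ind {i, j, k} b * ind {i, j, k} c) := by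
  have hr3 : 0 ≤ 8 * r ^ 3 := by positivity
  have hr2 : 0 ≤ 4 * r ^ 2 := by positivity
  have hrhs : 0 ≤ 8 * r ^ 3 * (ind {i, j, k} a * ind {i, j, k} b + ind {i, j, k} a * ind {i, j, k} c
        + ind {i, j, k} b * ind {i, j, k} c)
      + 4 * r ^ 2 * (ind {i, j, k} a * ind {i, j, k} b * ind {i, j, k} c) := by
    have ha := ind_nonneg {i, j, k} a
    have hb := ind_nonneg {i, j, k} b
    have hc := ind_nonneg {i, j, k} c
    positivity
  by_cases h : i ≠ j ∧ i ≠ k ∧ j ≠ k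
  swap
  · simpa [F, if_neg h] using hrhs
  by_cases h' : a ≠ b ∧ a ≠ c ∧ b ≠ c
  swap
  · simpa [F, if_neg h'] using hrhs
  rw [FF_cov R h h']
  have hpq : 0 ≤ (∫ X, T R a b c X) * ∫ X, T R i j k X :=
    mul_nonneg (integral_nonneg (T_nice _ _ _ _).nonneg) (integral_nonneg (T_nice _ _ _ _).nonneg)
  obtain ⟨hij, hik, hjk⟩ := h
  obtain ⟨hab, hac, hbc⟩ := h'
  have nm : ∀ x : Fin n, x ∉ ({i, j, k} : Finset (Fin n)) → x ≠ i ∧ x ≠ j ∧ x ≠ k := by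
    intro x hx; simpa [not_or] using hx
  by_cases ha : a ∈ ({i, j, k} : Finset (Fin n)) <;>
  by_cases hb : b ∈ ({i, j, k} : Finset (Fin n)) <;>
  by_cases hc : c ∈ ({i, j, k} : Finset (Fin n))
  · have := TT_two hr hR (a := a) (b := b) (c := c) hij hik hjk
    simp only [ind, ha, hb, hc, if_true]
    linarith
  · obtain ⟨h1, h2, h3⟩ := nm c hc
    have := TT_three hr hR (a := a) (b := b) (c := c) hij hik hjk hac.symm h1 h2 h3
    rw [T_rot R c] at this
    simp only [ind, ha, hb, hc, if_true, if_false]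
    linarith
  · obtain ⟨h1, h2, h3⟩ := nm b hb
    have := TT_three hr hR (a := c) (b := a) (c := b) hij hik hjk hbc h1 h2 h3
    rw [T_rot R b, T_rot R c] at this
    simp only [ind, ha, hb, hc, if_true, if_false]
    linarith
  · obtain ⟨h1, h2, h3⟩ := nm b hb
    obtain ⟨h4, h5, h6⟩ := nm c hc
    have := TT_zero R hab hac h1 h2 h3 h4 h5 h6
    linarith
  · obtain ⟨h1, h2, h3⟩ := nm a ha
    have := TT_three hr hR (a := b) (b := c) (c := a) hij hik hjk hab h1 h2 h3
    simp only [ind, ha, hb, hc, if_true, if_false]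
    linarith
  · obtain ⟨h1, h2, h3⟩ := nm a ha
    obtain ⟨h4, h5, h6⟩ := nm c hc
    have := TT_zero R hbc hab.symm h4 h5 h6 h1 h2 h3
    rw [← T_rot R a] at this
    linarith
  · obtain ⟨h1, h2, h3⟩ := nm a ha
    obtain ⟨h4, h5, h6⟩ := nm b hb
    have := TT_zero R hac.symm hbc.symm h1 h2 h3 h4 h5 h6
    rw [T_rot R c] at this
    linarith
  · obtain ⟨h1, h2, h3⟩ := nm b hb
    obtain ⟨h4, h5, h6⟩ := nm c hc
    have := TT_zero R hab hac h1 h2 h3 h4 h5 h6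
    linarith

lemma circle_bound {n : ℕ} {R : Fin n → Fin n → ℝ} {r : ℝ} (hr : 0 ≤ r) (hR : ∀ i j, R i j ≤ r) :
    ∫ X, (∑ i, ∑ j, ∑ k, F R i j k X) ^ 2 ≤ 216 * ((n : ℝ) ^ 4 * r ^ 3 + (n : ℝ) ^ 3 * r ^ 2) := by
  have e1 : ∀ X, (∑ i, ∑ j, ∑ k, F R i j k X) ^ 2
      = ∑ i, ∑ j, ∑ k, ∑ a, ∑ b, ∑ c, F R a b c X * F R i j k X := by
    intro X
    rw [sq, Finset.mul_sum]
    simp_rw [Finset.mul_sum, Finset.sum_mul]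
  simp_rw [e1]
  have e2 : ∫ X, (∑ i, ∑ j, ∑ k, ∑ a, ∑ b, ∑ c, F R a b c X * F R i j k X)
      = ∑ i, ∑ j, ∑ k, ∑ a, ∑ b, ∑ c, ∫ X, F R a b c X * F R i j k X := by
    have I := FF_int R
    rw [integral_finsetSum _ fun i _ => integrable_finsetSum _ fun j _ => integrable_finsetSum _
      fun k _ => integrable_finsetSum _ fun a _ => integrable_finsetSum _ fun b _ =>
      integrable_finsetSum _ fun c _ => I i j k a b c]
    refine Finset.sum_congr rfl fun i _ => ?_
    rw [integral_finsetSum _ fun j _ => integrable_finsetSum _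
      fun k _ => integrable_finsetSum _ fun a _ => integrable_finsetSum _ fun b _ =>
      integrable_finsetSum _ fun c _ => I i j k a b c]
    refine Finset.sum_congr rfl fun j _ => ?_
    rw [integral_finsetSum _
      fun k _ => integrable_finsetSum _ fun a _ => integrable_finsetSum _ fun b _ =>
      integrable_finsetSum _ fun c _ => I i j k a b c]
    refine Finset.sum_congr rfl fun k _ => ?_
    rw [integral_finsetSum _ fun a _ => integrable_finsetSum _ fun b _ =>
      integrable_finsetSum _ fun c _ => I i j k a b c]
    refine Finset.sum_congr rfl fun a _ => ?_
    rw [integral_finsetSum _ fun b _ => integrable_finsetSum _ fun c _ => I i j k a b c]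
    refine Finset.sum_congr rfl fun b _ => ?_
    rw [integral_finsetSum _ fun c _ => I i j k a b c]
  rw [e2]
  have e3 : ∀ i j k : Fin n, ∑ a, ∑ b, ∑ c, ∫ X, F R a b c X * F R i j k X
      ≤ 216 * (n * r ^ 3 + r ^ 2) := by
    intro i j k
    refine (Finset.sum_le_sum fun a _ => Finset.sum_le_sum fun b _ => Finset.sum_le_sum fun c _ =>
      FF_bound hr hR i j k a b c).trans ?_
    have hS := sum_ind i j k
    set S := ∑ a, ind {i, j, k} a with hSd
    have hS0 : 0 ≤ S := Finset.sum_nonneg fun a _ => ind_nonneg _ _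
    have : ∑ a, ∑ b, ∑ c, (8 * r ^ 3 * (ind {i, j, k} a * ind {i, j, k} b
        + ind {i, j, k} a * ind {i, j, k} c + ind {i, j, k} b * ind {i, j, k} c)
      + 4 * r ^ 2 * (ind {i, j, k} a * ind {i, j, k} b * ind {i, j, k} c))
      = 8 * r ^ 3 * (3 * n * S ^ 2) + 4 * r ^ 2 * S ^ 3 := by
      simp only [Finset.sum_add_distrib, ← Finset.mul_sum, ← Finset.sum_mul, Finset.sum_const,
        Finset.card_univ, Fintype.card_fin, nsmul_eq_mul, ← hSd]
      ring
    rw [this]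
    have h2 : S ^ 2 ≤ 3 ^ 2 := by gcongr
    have h3 : S ^ 3 ≤ 3 ^ 3 := by gcongr
    calc 8 * r ^ 3 * (3 * n * S ^ 2) + 4 * r ^ 2 * S ^ 3
        ≤ 8 * r ^ 3 * (3 * n * 3 ^ 2) + 4 * r ^ 2 * 3 ^ 3 := by gcongr
      _ ≤ _ := by nlinarith [sq_nonneg r]
  refine (Finset.sum_le_sum fun i _ => Finset.sum_le_sum fun j _ => Finset.sum_le_sum fun k _ =>
      e3 i j k).trans ?_
  simp only [Finset.sum_const, Finset.card_univ, Fintype.card_fin, nsmul_eq_mul]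
  apply le_of_eq; ring

lemma mk_mp (n : ℕ) : MeasurePreserving (fun (X : Fin n → ℝ) l => ((X l : ℝ) : UnitAddCircle))
    (gbmMeasure n) volume := by
  unfold gbmMeasure
  have h := UnitAddCircle.measurePreserving_mk 0
  rw [zero_add, Measure.restrict_congr_set Ioc_ae_eq_Icc] at h
  exact measurePreserving_pi _ _ fun _ => h

lemma gbm_ae (n : ℕ) : ∀ᵐ X ∂gbmMeasure n, ∀ l, X l ∈ Set.Icc (0 : ℝ) 1 := by
  rw [ae_all_iff]
  intro l
  unfold gbmMeasure
  exact (Measure.tendsto_eval_ae_ae (i := l)).eventually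
    (ae_restrict_mem measurableSet_Icc)

lemma transfer {n : ℕ} {g : (Fin n → ℝ) → ℝ} {G : (Fin n → UnitAddCircle) → ℝ} (hG : Measurable G)
    (h : ∀ X, (∀ l, X l ∈ Set.Icc (0 : ℝ) 1) → g X = G (fun l => (X l : UnitAddCircle))) :
    ∫ X, g X ∂gbmMeasure n = ∫ X, G X := by
  rw [← (mk_mp n).map_eq, integral_map (mk_mp n).measurable.aemeasurable hG.aestronglyMeasurable]
  refine integral_congr_ae ?_
  filter_upwards [gbm_ae n] with X hX using h X hX

lemma pdist_eq {u v : ℝ} (hu : u ∈ Set.Icc (0 : ℝ) 1) (hv : v ∈ Set.Icc (0 : ℝ) 1) :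
    pdist u v = ‖(u : UnitAddCircle) - (v : UnitAddCircle)‖ := by
  obtain ⟨h1, h2⟩ := hu
  obtain ⟨h3, h4⟩ := hv
  rw [← AddCircle.coe_sub, UnitAddCircle.norm_eq, abs_sub_round_eq_min]
  unfold pdist
  rcases lt_trichotomy (u - v) 0 with h | h | h
  · rcases eq_or_lt_of_le (show -1 ≤ u - v by linarith) with h' | h'
    · rw [← h']; norm_num
    · have : Int.fract (u - v) = u - v + 1 := by
        rw [Int.fract_eq_iff]
        exact ⟨by linarith, by linarith, -1, by push_cast; ring⟩
      rw [this, abs_of_neg h, min_comm]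
      congr 1 <;> ring
  · rw [h]; norm_num
  · rcases eq_or_lt_of_le (show u - v ≤ 1 by linarith) with h' | h'
    · rw [h']; norm_num
    · have : Int.fract (u - v) = u - v := by
        rw [Int.fract_eq_self]; exact ⟨h.le, h'⟩
      rw [this, abs_of_pos h]

end GBM

/-- Second-moment bound for the centered number of ordered triangles: there is an
absolute constant `C > 0` (independent of `n`, `m`/`τ`, `r_s`, `r_d`) such that
`E[T_n²] ≤ C (n⁴ r_s³ + n³ r_s²)` for every geometric block model with
`0 ≤ r_d ≤ r_s ≤ 1/4`. -/
theorem centered_triangles_variance_bound :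
    ∃ C : ℝ, 0 < C ∧
      ∀ (n m : ℕ), m ≤ n → ∀ (rs rd : ℝ), 0 ≤ rd → rd ≤ rs → rs ≤ 1 / 4 →
        (∫ X, (∑ i : Fin n, ∑ j : Fin n, ∑ k : Fin n,
            if i ≠ j ∧ i ≠ k ∧ j ≠ k then
              gbmA n m rs rd X i j * gbmA n m rs rd X j k * gbmA n m rs rd X k i
                - ∫ Y, gbmA n m rs rd Y i j * gbmA n m rs rd Y j k * gbmA n m rs rd Y k i
                    ∂gbmMeasure n
            else 0) ^ 2 ∂gbmMeasure n)
          ≤ C * ((n : ℝ) ^ 4 * rs ^ 3 + (n : ℝ) ^ 3 * rs ^ 2) := by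
  refine ⟨216, by norm_num, ?_⟩
  intro n m _ rs rd h0 hd _
  set R : Fin n → Fin n → ℝ := fun i j => if ((i : ℕ) < m ↔ (j : ℕ) < m) then rs else rd with hRdef
  have hR : ∀ i j, R i j ≤ rs := by
    intro i j; simp only [hRdef]; split_ifs <;> linarith
  have hA : ∀ (X : Fin n → ℝ), (∀ l, X l ∈ Set.Icc (0 : ℝ) 1) → ∀ i j, i ≠ j →
      gbmA n m rs rd X i j = GBM.e (R i j) (X i : UnitAddCircle) (X j : UnitAddCircle) := by
    intro X hX i j hij
    simp only [gbmA, if_neg hij, GBM.e, hRdef, GBM.pdist_eq (hX i) (hX j)]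
    split_ifs <;> rfl
  have hT : ∀ (X : Fin n → ℝ), (∀ l, X l ∈ Set.Icc (0 : ℝ) 1) → ∀ i j k,
      i ≠ j ∧ i ≠ k ∧ j ≠ k →
      gbmA n m rs rd X i j * gbmA n m rs rd X j k * gbmA n m rs rd X k i
        = GBM.T R i j k (fun l => (X l : UnitAddCircle)) := by
    intro X hX i j k h
    rw [hA X hX i j h.1, hA X hX j k h.2.2, hA X hX k i h.2.1.symm]
    rfl
  refine le_of_eq_of_le ?_ (GBM.circle_bound (h0.trans hd) hR)
  refine GBM.transfer ?_ ?_
  · refine Measurable.pow_const ?_ 2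
    exact Finset.measurable_sum _ fun i _ => Finset.measurable_sum _ fun j _ =>
      Finset.measurable_sum _ fun k _ => GBM.F_meas R i j k
  · intro X hX
    congr 1
    refine Finset.sum_congr rfl fun i _ => Finset.sum_congr rfl fun j _ =>
      Finset.sum_congr rfl fun k _ => ?_
    unfold GBM.F
    by_cases h : i ≠ j ∧ i ≠ k ∧ j ≠ k
    · rw [if_pos h, if_pos h, hT X hX i j k h]
      congr 1
      exact GBM.transfer (GBM.T_nice R i j k).meas fun Y hY => hT Y hY i j k h
    · rw [if_neg h, if_neg h]
end
end

section
/- Consider the sequence of geometric block models G_n(r_s(n), r_d(n)) with τ = 1/2 (balanced communities, n even), radii 0 < r_d(n) ≤ r_s(n) ≤ 1/4 satisfying r_s(n) = Θ(r_d(n)) and n·r_s(n) → ∞. Define L_n as follows, writing r_s = r_s(n), r_d = r_d(n): if r_d ≤ r_s < 2r_d, then L_n = 3 r_s r_d / (r_s + r_d)²; if r_s ≥ 2r_d, then L_n = 3(r_s² + 4r_d²) / (4(r_s + r_d)²). Then the global clustering coefficient C_n satisfies C_n − L_n → 0 in probability: for every ε > 0, P(|C_n − L_n| > ε) → 0 as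 n → ∞. -/
open MeasureTheory Finset

noncomputable section

/-- Ordered triangle count `Σ_{i≠j≠k} A_ij A_jk A_ki`. -/
def triSum (n m : ℕ) (rs rd : ℝ) (X : Fin n → ℝ) : ℝ :=
  ∑ i : Fin n, ∑ j : Fin n, ∑ k : Fin n,
    if i ≠ j ∧ i ≠ k ∧ j ≠ k then
      gbmA n m rs rd X i j * gbmA n m rs rd X j k * gbmA n m rs rd X k i
    else 0

/-- Ordered 2-path count `Σ_{i≠j≠k} A_ij A_ik`. -/
def pathSum (n m : ℕ) (rs rd : ℝ) (X : Fin n → ℝ) : ℝ :=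
  ∑ i : Fin n, ∑ j : Fin n, ∑ k : Fin n,
    if i ≠ j ∧ i ≠ k ∧ j ≠ k then
      gbmA n m rs rd X i j * gbmA n m rs rd X i k
    else 0

/-- The global clustering coefficient `C_n = (Σ A_ij A_jk A_ki)/(Σ A_ij A_ik)`
(by Lean's convention `x / 0 = 0`, it is `0` when the denominator vanishes). -/
def globalCC (n m : ℕ) (rs rd : ℝ) (X : Fin n → ℝ) : ℝ :=
  triSum n m rs rd X / pathSum n m rs rd X

open ProbabilityTheory

abbrev lam : Measure ℝ := volume.restrict (Set.Icc (0 : ℝ) 1)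

instance lam_prob : IsProbabilityMeasure lam := ⟨by simp [lam]⟩

instance gbm_prob (n : ℕ) : IsProbabilityMeasure (gbmMeasure n) := by
  unfold gbmMeasure
  have : ∀ _ : Fin n, IsProbabilityMeasure (volume.restrict (Set.Icc (0 : ℝ) 1)) :=
    fun _ => lam_prob
  infer_instance

lemma resample (n : ℕ) (i : Fin n) :
    MeasurePreserving (fun p : ℝ × (Fin n → ℝ) => Function.update p.2 i p.1)
      (lam.prod (gbmMeasure n)) (gbmMeasure n) := by
  have hm : Measurable (fun p : ℝ × (Fin n → ℝ) => Function.update p.2 i p.1) := by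
    rw [measurable_pi_iff]
    intro j
    by_cases h : j = i
    · subst h
      simpa using measurable_fst
    · simp only [Function.update_of_ne h]
      fun_prop
  refine ⟨hm, ?_⟩
  symm
  conv_lhs => unfold gbmMeasure
  refine Measure.pi_eq fun s hs => ?_
  rw [Measure.map_apply hm (MeasurableSet.univ_pi hs)]
  have : (fun p : ℝ × (Fin n → ℝ) => Function.update p.2 i p.1) ⁻¹' (Set.univ.pi s) =
      s i ×ˢ (Set.univ.pi (Function.update s i Set.univ)) := by
    ext ⟨u, X⟩
    simp only [Set.mem_preimage, Set.mem_pi, Set.mem_univ, true_imp_iff, Set.mem_prod]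
    constructor
    · intro h
      refine ⟨by simpa using h i, fun j => ?_⟩
      by_cases hj : j = i
      · subst hj; simp
      · simpa [Function.update_of_ne hj] using h j
    · rintro ⟨h1, h2⟩ j
      by_cases hj : j = i
      · subst hj; simpa using h1
      · simpa [Function.update_of_ne hj] using h2 j
  rw [this, Measure.prod_prod]
  unfold gbmMeasure
  rw [Measure.pi_pi, ← Finset.mul_prod_erase univ _ (Finset.mem_univ i),
    ← Finset.mul_prod_erase univ (fun j => (volume.restrict (Set.Icc (0 : ℝ) 1)) (s j))
      (Finset.mem_univ i)]
  simp only [Function.update_self]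
  have h1 : (volume.restrict (Set.Icc (0 : ℝ) 1)) Set.univ = 1 := by simp
  rw [h1, one_mul]
  congr 1
  refine Finset.prod_congr rfl fun j hj => ?_
  rw [Function.update_of_ne (Finset.ne_of_mem_erase hj)]

lemma integral_prod_B (n : ℕ) (B : ℝ → ℝ) (s : Finset (Fin n)) :
    ∫ X, ∏ i ∈ s, B (X i) ∂(gbmMeasure n) = (∫ x, B x ∂lam) ^ s.card := by
  have h := integral_fintype_prod_eq_prod (𝕜 := ℝ) (ι := Fin n) (E := fun _ => ℝ)
    (fun i x => if i ∈ s then B x else 1) (μ := fun _ => lam)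
  have e : ∀ X : Fin n → ℝ, ∏ i, (if i ∈ s then B (X i) else 1) = ∏ i ∈ s, B (X i) := by
    intro X
    rw [Finset.prod_ite_mem]; simp
  simp only [e] at h
  unfold gbmMeasure
  rw [h]
  have : ∀ i, (∫ x, (if i ∈ s then B x else 1) ∂lam) = if i ∈ s then ∫ x, B x ∂lam else 1 := by
    intro i
    split_ifs
    · rfl
    · simp
  simp only [this]
  rw [Finset.prod_ite_mem]; simp

lemma gbm_iIndep (n : ℕ) :
    iIndepFun (fun (i : Fin n) (X : Fin n → ℝ) => X i) (gbmMeasure n) := by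
  have := iIndepFun_pi (μ := fun _ : Fin n => lam) (X := fun _ x => x)
    (fun i => measurable_id.aemeasurable)
  exact this

lemma gbm_map (n : ℕ) (i : Fin n) : (gbmMeasure n).map (fun X => X i) = lam :=
  (measurePreserving_eval (fun _ : Fin n => lam) i).map_eq

lemma gbm_integral_pair (n : ℕ) (j k : Fin n) (hjk : j ≠ k) (h : ℝ → ℝ → ℝ)
    (hm : Measurable (Function.uncurry h)) (hb : ∀ x y, |h x y| ≤ 1) :
    ∫ X, h (X j) (X k) ∂(gbmMeasure n) = ∫ x, ∫ y, h x y ∂lam ∂lam := by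
  have h1 := (gbm_iIndep n).indepFun hjk
  rw [indepFun_iff_map_prod_eq_prod_map_map (measurable_pi_apply j).aemeasurable
    (measurable_pi_apply k).aemeasurable, gbm_map, gbm_map] at h1
  have h2 : ∫ X, Function.uncurry h (X j, X k) ∂(gbmMeasure n)
      = ∫ z, Function.uncurry h z ∂(lam.prod lam) := by
    rw [← h1, integral_map (by fun_prop) hm.aestronglyMeasurable]
  have h3 := integral_prod (μ := lam) (ν := lam) (Function.uncurry h)
    (Integrable.of_bound hm.aestronglyMeasurable 1 (ae_of_all _ fun z => by
      exact hb z.1 z.2))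
  rw [h3] at h2
  exact h2

lemma BBB (n : ℕ) (B : ℝ → ℝ) (hB0 : ∀ x, 0 ≤ B x) (hBsq : ∀ x, B x * B x = B x)
    (p : ℝ) (hp : ∫ x, B x ∂lam = p)
    (a b c : Fin n) (hab : a ≠ b) (hac : a ≠ c) :
    ∫ X, B (X a) * B (X b) * B (X c) ∂(gbmMeasure n) ≤ p ^ 3 + if b = c then p ^ 2 else 0 := by
  have hp0 : 0 ≤ p := hp ▸ integral_nonneg hB0
  split_ifs with hbc
  · subst hbc
    have := integral_prod_B n B {a, b}
    rw [Finset.card_pair hab, hp] at this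
    have e : ∀ X : Fin n → ℝ, B (X a) * B (X b) * B (X b) = ∏ i ∈ ({a, b} : Finset (Fin n)), B (X i) := by
      intro X
      rw [Finset.prod_pair hab, mul_assoc, hBsq]
    simp only [e, this]
    have := pow_nonneg hp0 3
    linarith
  · have := integral_prod_B n B {a, b, c}
    rw [Finset.card_eq_three.2 ⟨a, b, c, hab, hac, hbc, rfl⟩, hp] at this
    have e : ∀ X : Fin n → ℝ, B (X a) * B (X b) * B (X c) = ∏ i ∈ ({a, b, c} : Finset (Fin n)), B (X i) := by
      intro X
      rw [Finset.prod_insert (by simp [hab, hac]), Finset.prod_pair hbc, mul_assoc]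
    simp only [e, this]
    linarith

lemma var_bound (n : ℕ) (B : ℝ → ℝ) (hBm : Measurable B) (hB0 : ∀ x, 0 ≤ B x)
    (hBsq : ∀ x, B x * B x = B x)
    (p : ℝ) (hp : ∫ x, B x ∂lam = p)
    (h : Fin n × Fin n → ℝ → ℝ → ℝ) (hm : ∀ t, Measurable (Function.uncurry (h t)))
    (hh0 : ∀ t x y, 0 ≤ h t x y) (hhB : ∀ t x y, h t x y ≤ B x * B y)
    (c : Fin n × Fin n → ℝ) (hc : ∀ t, ∫ x, ∫ y, h t x y ∂lam ∂lam = c t)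
    (S : Finset (Fin n × Fin n)) (hS : ∀ t ∈ S, t.1 ≠ t.2) :
    ∫ X, (∑ t ∈ S, (h t (X t.1) (X t.2) - c t)) ^ 2 ∂(gbmMeasure n)
      ≤ 4 * ((n : ℝ) ^ 3 * p ^ 3 + (n : ℝ) ^ 2 * p ^ 2) := by
  have hp0 : 0 ≤ p := hp ▸ integral_nonneg hB0
  have hB1 : ∀ x, B x ≤ 1 := fun x => by nlinarith [hBsq x, hB0 x]
  have hh1 : ∀ t x y, h t x y ≤ 1 := fun t x y =>
    (hhB t x y).trans (mul_le_one₀ (hB1 x) (hB0 y) (hB1 y))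
  have hc0 : ∀ t, 0 ≤ c t := fun t => by
    rw [← hc t]; exact integral_nonneg fun x => integral_nonneg fun y => hh0 t x y
  have hYm : ∀ t, Measurable (fun X : Fin n → ℝ => h t (X t.1) (X t.2)) := fun t =>
    (hm t).comp (f := fun X : Fin n → ℝ => (X t.1, X t.2)) (by fun_prop)
  have hYi : ∀ t, Integrable (fun X : Fin n → ℝ => h t (X t.1) (X t.2)) (gbmMeasure n) := fun t =>
    Integrable.of_bound (hYm t).aestronglyMeasurable 1 (ae_of_all _ fun X => by
      rw [Real.norm_eq_abs, abs_of_nonneg (hh0 _ _ _)]; exact hh1 _ _ _)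
  have hYYi : ∀ t t', Integrable (fun X : Fin n → ℝ => h t (X t.1) (X t.2) * h t' (X t'.1) (X t'.2))
      (gbmMeasure n) := fun t t' =>
    Integrable.of_bound ((hYm t).mul (hYm t')).aestronglyMeasurable 1 (ae_of_all _ fun X => by
      rw [Real.norm_eq_abs, abs_of_nonneg (mul_nonneg (hh0 _ _ _) (hh0 _ _ _))]
      exact mul_le_one₀ (hh1 _ _ _) (hh0 _ _ _) (hh1 _ _ _))
  have hE : ∀ t ∈ S, ∫ X, h t (X t.1) (X t.2) ∂(gbmMeasure n) = c t := fun t ht => by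
    rw [gbm_integral_pair n t.1 t.2 (hS t ht) (h t) (hm t) (fun x y => by
      rw [abs_of_nonneg (hh0 _ _ _)]; exact hh1 _ _ _), hc]
  have hcov : ∀ t ∈ S, ∀ t' ∈ S,
      ∫ X, (h t (X t.1) (X t.2) - c t) * (h t' (X t'.1) (X t'.2) - c t') ∂(gbmMeasure n)
      = ∫ X, h t (X t.1) (X t.2) * h t' (X t'.1) (X t'.2) ∂(gbmMeasure n) - c t * c t' := by
    intro t ht t' ht'
    have e : ∀ X : Fin n → ℝ, (h t (X t.1) (X t.2) - c t) * (h t' (X t'.1) (X t'.2) - c t')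
        = h t (X t.1) (X t.2) * h t' (X t'.1) (X t'.2) - c t' * h t (X t.1) (X t.2)
          - c t * h t' (X t'.1) (X t'.2) + c t * c t' := fun X => by ring
    simp only [e]
    have i1 : Integrable (fun X : Fin n → ℝ => h t (X t.1) (X t.2) * h t' (X t'.1) (X t'.2)
        - c t' * h t (X t.1) (X t.2)) (gbmMeasure n) := (hYYi t t').sub ((hYi t).const_mul _)
    have i2 : Integrable (fun X : Fin n → ℝ => h t (X t.1) (X t.2) * h t' (X t'.1) (X t'.2)
        - c t' * h t (X t.1) (X t.2) - c t * h t' (X t'.1) (X t'.2)) (gbmMeasure n) :=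
      i1.sub ((hYi t').const_mul _)
    rw [integral_add i2 (integrable_const _), integral_sub i1 ((hYi t').const_mul _),
      integral_sub (hYYi t t') ((hYi t).const_mul _), integral_const_mul, integral_const_mul,
      hE t ht, hE t' ht']
    simp
    ring
  -- pairwise bound
  let e : Fin n × Fin n → Fin n × Fin n → ℝ := fun t t' =>
    (if t.1 = t'.1 then p ^ 3 + (if t.2 = t'.2 then p ^ 2 else 0) else 0)
    + (if t.1 = t'.2 then p ^ 3 + (if t.2 = t'.1 then p ^ 2 else 0) else 0)
    + (if t.2 = t'.1 then p ^ 3 + (if t.1 = t'.2 then p ^ 2 else 0) else 0)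
    + (if t.2 = t'.2 then p ^ 3 + (if t.1 = t'.1 then p ^ 2 else 0) else 0)
  have hite : ∀ (P Q : Prop) [Decidable P] [Decidable Q],
      0 ≤ (if P then p ^ 3 + (if Q then p ^ 2 else 0) else 0) := by
    intro P Q _ _
    split_ifs <;> positivity
  have he0 : ∀ t t', 0 ≤ e t t' := fun t t' => by
    have h1 := hite (t.1 = t'.1) (t.2 = t'.2)
    have h2 := hite (t.1 = t'.2) (t.2 = t'.1)
    have h3 := hite (t.2 = t'.1) (t.1 = t'.2)
    have h4 := hite (t.2 = t'.2) (t.1 = t'.1)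
    simp only [e]; linarith
  have key : ∀ (t t' : Fin n × Fin n) (a b d : Fin n), a ≠ b → a ≠ d →
      (∀ X : Fin n → ℝ, B (X t.1) * B (X t.2) * (B (X t'.1) * B (X t'.2)) = B (X a) * B (X b) * B (X d)) →
      ∫ X, h t (X t.1) (X t.2) * h t' (X t'.1) (X t'.2) ∂(gbmMeasure n) ≤
        p ^ 3 + if b = d then p ^ 2 else 0 := by
    intro t t' a b d hab had hX
    refine le_trans (integral_mono (hYYi t t') (g := fun X => B (X a) * B (X b) * B (X d)) ?_ ?_)
      (BBB n B hB0 hBsq p hp a b d hab had)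
    · refine Integrable.of_bound (by fun_prop) 1 (ae_of_all _ fun X => ?_)
      rw [Real.norm_eq_abs, abs_of_nonneg (mul_nonneg (mul_nonneg (hB0 _) (hB0 _)) (hB0 _))]
      exact mul_le_one₀ (mul_le_one₀ (hB1 _) (hB0 _) (hB1 _)) (hB0 _) (hB1 _)
    · intro X
      simp only
      rw [← hX]
      exact mul_le_mul (hhB _ _ _) (hhB _ _ _) (hh0 _ _ _) (mul_nonneg (hB0 _) (hB0 _))
  have hpair : ∀ t ∈ S, ∀ t' ∈ S,
      ∫ X, (h t (X t.1) (X t.2) - c t) * (h t' (X t'.1) (X t'.2) - c t') ∂(gbmMeasure n) ≤ e t t' := by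
    intro t ht t' ht'
    rw [hcov t ht t' ht']
    have hcc := mul_nonneg (hc0 t) (hc0 t')
    have h1 := hite (t.1 = t'.1) (t.2 = t'.2)
    have h2 := hite (t.1 = t'.2) (t.2 = t'.1)
    have h3 := hite (t.2 = t'.1) (t.1 = t'.2)
    have h4 := hite (t.2 = t'.2) (t.1 = t'.1)
    have nt := hS t ht
    have nt' := hS t' ht'
    by_cases q1 : t.1 = t'.1
    · have := key t t' t.1 t.2 t'.2 nt (q1 ▸ nt') (fun X => by
        rw [← q1]; linear_combination (B (X t.2) * B (X t'.2)) * hBsq (X t.1))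
      simp only [e]
      rw [if_pos q1] at h1 ⊢
      linarith
    by_cases q2 : t.1 = t'.2
    · have := key t t' t.1 t.2 t'.1 nt (q2 ▸ nt'.symm) (fun X => by
        rw [← q2]; linear_combination (B (X t.2) * B (X t'.1)) * hBsq (X t.1))
      simp only [e]
      rw [if_pos q2] at h2 ⊢
      linarith
    by_cases q3 : t.2 = t'.1
    · have := key t t' t.2 t.1 t'.2 nt.symm (q3 ▸ nt') (fun X => by
        rw [← q3]; linear_combination (B (X t.1) * B (X t'.2)) * hBsq (X t.2))
      simp only [e]
      have g : (if t.2 = t'.1 then p ^ 3 + (if t.1 = t'.2 then p ^ 2 else 0) else 0) = _ := if_pos q3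
      linarith
    by_cases q4 : t.2 = t'.2
    · have := key t t' t.2 t.1 t'.1 nt.symm (q4 ▸ nt'.symm) (fun X => by
        rw [← q4]; linear_combination (B (X t.1) * B (X t'.1)) * hBsq (X t.2))
      simp only [e]
      have g : (if t.2 = t'.2 then p ^ 3 + (if t.1 = t'.1 then p ^ 2 else 0) else 0) = _ := if_pos q4
      linarith
    have ind := (gbm_iIndep n).indepFun_prodMk_prodMk (fun i => by fun_prop) t.1 t.2 t'.1 t'.2
      q1 q2 q3 q4
    have ind2 := ind.comp (hm t) (hm t')
    have := ind2.integral_fun_mul_eq_mul_integral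
      (hYm t).aestronglyMeasurable (hYm t').aestronglyMeasurable
    simp only [Function.comp_def, Function.uncurry] at this
    rw [this, hE t ht, hE t' ht']
    simpa using he0 t t'
  calc ∫ X, (∑ t ∈ S, (h t (X t.1) (X t.2) - c t)) ^ 2 ∂(gbmMeasure n)
      = ∑ t ∈ S, ∑ t' ∈ S,
        ∫ X, (h t (X t.1) (X t.2) - c t) * (h t' (X t'.1) (X t'.2) - c t') ∂(gbmMeasure n) := by
        have hi : ∀ t t', Integrable (fun X : Fin n → ℝ =>
            (h t (X t.1) (X t.2) - c t) * (h t' (X t'.1) (X t'.2) - c t')) (gbmMeasure n) := by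
          intro t t'
          have e : ∀ X : Fin n → ℝ, (h t (X t.1) (X t.2) - c t) * (h t' (X t'.1) (X t'.2) - c t')
            = h t (X t.1) (X t.2) * h t' (X t'.1) (X t'.2) - c t' * h t (X t.1) (X t.2)
              - c t * h t' (X t'.1) (X t'.2) + c t * c t' := fun X => by ring
          simp only [e]
          exact (((hYYi t t').sub ((hYi t).const_mul _)).sub ((hYi t').const_mul _)).add
            (integrable_const _)
        simp only [sq, Finset.sum_mul_sum]
        rw [integral_finsetSum _ (fun t _ => integrable_finsetSum _ fun t' _ => hi t t')]
        refine Finset.sum_congr rfl fun t _ => ?_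
        rw [integral_finsetSum _ (fun t' _ => hi t t')]
    _ ≤ ∑ t ∈ S, ∑ t' ∈ S, e t t' :=
        Finset.sum_le_sum fun t ht => Finset.sum_le_sum fun t' ht' => hpair t ht t' ht'
    _ ≤ ∑ t, ∑ t', e t t' := by
        refine le_trans (Finset.sum_le_sum fun t _ =>
          Finset.sum_le_univ_sum_of_nonneg (fun t' => he0 t t')) ?_
        exact Finset.sum_le_univ_sum_of_nonneg
          (fun t => Finset.sum_nonneg fun t' _ => he0 t t')
    _ = 4 * ((n : ℝ) ^ 3 * p ^ 3 + (n : ℝ) ^ 2 * p ^ 2) := by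
        simp only [e, Fintype.sum_prod_type, Finset.sum_add_distrib]
        have s1 : ∀ a b : Fin n, (∑ x : Fin n, ∑ y : Fin n,
            if a = x then p ^ 3 + (if b = y then p ^ 2 else 0) else 0) = n * p ^ 3 + p ^ 2 := by
          intro a b
          rw [Finset.sum_comm]
          simp [Finset.sum_add_distrib]
        have s2 : ∀ a b : Fin n, (∑ x : Fin n, ∑ y : Fin n,
            if a = y then p ^ 3 + (if b = x then p ^ 2 else 0) else 0) = n * p ^ 3 + p ^ 2 := by
          intro a b
          simp [Finset.sum_add_distrib]
        simp only [s1, s2]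
        simp
        ring

/-! ### Geometry on the circle -/

def cD (t : ℝ) : ℝ := min (Int.fract t) (1 - Int.fract t)

def cpsi (r t : ℝ) : ℝ := if cD t ≤ r then 1 else 0

lemma cD_eq_abs {t : ℝ} (h : |t| ≤ 1 / 2) : cD t = |t| := by
  rw [abs_le] at h
  unfold cD
  rcases le_or_gt 0 t with h0 | h0
  · rw [Int.fract_eq_self.2 ⟨h0, by linarith⟩, abs_of_nonneg h0, min_eq_left (by linarith)]
  · have : Int.fract t = t + 1 := by
      rw [← Int.fract_add_one]; exact Int.fract_eq_self.2 ⟨by linarith, by linarith⟩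
    rw [this, abs_of_neg h0, min_eq_right (by linarith)]
    ring

lemma cD_pdist {u v : ℝ} (hu : u ∈ Set.Icc (0 : ℝ) 1) (hv : v ∈ Set.Icc (0 : ℝ) 1) :
    cD (u - v) = pdist u v := by
  obtain ⟨u0, u1⟩ := hu
  obtain ⟨v0, v1⟩ := hv
  unfold cD pdist
  rcases le_or_gt 0 (u - v) with h0 | h0
  · rw [abs_of_nonneg h0]
    rcases eq_or_lt_of_le (show u - v ≤ 1 by linarith) with h1 | h1
    · rw [h1]; simp
    · rw [Int.fract_eq_self.2 ⟨h0, h1⟩]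
  · have : Int.fract (u - v) = u - v + 1 := by
      rw [← Int.fract_add_one]; exact Int.fract_eq_self.2 ⟨by linarith, by linarith⟩
    rw [this, abs_of_neg h0, min_comm]
    congr 1 <;> ring

lemma cD_neg (t : ℝ) : cD (-t) = cD t := by
  unfold cD
  by_cases h : Int.fract t = 0
  · rw [Int.fract_neg_eq_zero.2 h, h]
  · rw [Int.fract_neg h, min_comm]; congr 1; ring

lemma cpsi_neg (r t : ℝ) : cpsi r (-t) = cpsi r t := by simp [cpsi, cD_neg]

lemma cpsi_periodic (r : ℝ) : Function.Periodic (cpsi r) 1 := fun t => by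
  simp [cpsi, cD]

@[fun_prop]
lemma cD_meas : Measurable cD := by
  unfold cD
  exact measurable_fract.min (measurable_const.sub measurable_fract)

@[fun_prop]
lemma cpsi_meas (r : ℝ) : Measurable (cpsi r) := by
  unfold cpsi
  exact Measurable.ite (measurableSet_le cD_meas measurable_const) measurable_const measurable_const

lemma cpsi_nonneg (r t : ℝ) : 0 ≤ cpsi r t := by unfold cpsi; split_ifs <;> norm_num
lemma cpsi_le_one (r t : ℝ) : cpsi r t ≤ 1 := by unfold cpsi; split_ifs <;> norm_num
lemma cpsi_sq (r t : ℝ) : cpsi r t * cpsi r t = cpsi r t := by unfold cpsi; split_ifs <;> norm_num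
lemma cpsi_mono {r s : ℝ} (h : r ≤ s) (t : ℝ) : cpsi r t ≤ cpsi s t := by
  unfold cpsi
  split_ifs with h1 h2
  · exact le_rfl
  · exact absurd (h1.trans h) h2
  · norm_num
  · exact le_rfl

lemma cpsi_eq (r t : ℝ) (h : |t| ≤ 1 / 2) : cpsi r t = if |t| ≤ r then 1 else 0 := by
  unfold cpsi; rw [cD_eq_abs h]

lemma lam_shift (F : ℝ → ℝ) (hF : Function.Periodic F 1) (u : ℝ) :
    ∫ y, F (u - y) ∂lam = ∫ v in (-(1 / 2 : ℝ))..(1 / 2), F v := by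
  have h1 : ∫ y, F (u - y) ∂lam = ∫ y in (0 : ℝ)..1, F (u - y) := by
    rw [intervalIntegral.integral_of_le zero_le_one, ← integral_Icc_eq_integral_Ioc]
  rw [h1, intervalIntegral.integral_comp_sub_left]
  have := hF.intervalIntegral_add_eq (u - 1) (-(1 / 2))
  rw [show u - 1 + 1 = u by ring, show -(1 / 2 : ℝ) + 1 = 1 / 2 by norm_num] at this
  rw [sub_zero]
  exact this

lemma int_indicator (g : ℝ → ℝ) (F : ℝ → ℝ) (l r : ℝ) (hl : -(1 / 2) ≤ l) (hlr : l ≤ r) (hr : r ≤ 1 / 2)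
    (h : ∀ v, |v| ≤ 1 / 2 → g v = if l ≤ v ∧ v ≤ r then F v else 0) :
    ∫ v in (-(1 / 2 : ℝ))..(1 / 2), g v = ∫ v in l..r, F v := by
  rw [intervalIntegral.integral_of_le (by norm_num), ← integral_Icc_eq_integral_Ioc,
    intervalIntegral.integral_of_le hlr, ← integral_Icc_eq_integral_Ioc]
  have : ∫ v in Set.Icc (-(1 / 2 : ℝ)) (1 / 2), g v
      = ∫ v in Set.Icc (-(1 / 2 : ℝ)) (1 / 2), (Set.Icc l r).indicator F v := by
    refine setIntegral_congr_fun measurableSet_Icc fun v hv => ?_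
    rw [h v (abs_le.2 hv)]
    simp [Set.indicator]
  rw [this, setIntegral_indicator measurableSet_Icc]
  congr 2
  exact Set.inter_eq_right.2 (Set.Icc_subset_Icc hl hr)

lemma int_cpsi (r : ℝ) (h0 : 0 ≤ r) (h1 : r ≤ 1 / 4) (u : ℝ) :
    ∫ y, cpsi r (u - y) ∂lam = 2 * r := by
  rw [lam_shift _ (cpsi_periodic r), int_indicator _ (fun _ => 1) (-r) r (by linarith) (by linarith) (by linarith)]
  · simp; ring
  · intro v hv
    rw [cpsi_eq r v hv]
    simp only [abs_le]

def cJ (b c w : ℝ) : ℝ := ∫ v in (-(1 / 2 : ℝ))..(1 / 2), cpsi b v * cpsi c (w - v)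

lemma cJ_aux (b c w : ℝ) (hb0 : 0 ≤ b) (hb : b ≤ 1 / 4) (hc0 : 0 ≤ c) (hw : |w| ≤ 1 / 4)
    (hbw : |w| ≤ b + c) :
    cJ b c w = min b (w + c) - max (-b) (w - c) := by
  unfold cJ
  obtain ⟨w1, w2⟩ := abs_le.1 hw
  obtain ⟨w3, w4⟩ := abs_le.1 hbw
  rw [int_indicator _ (fun _ => 1) (max (-b) (w - c)) (min b (w + c))]
  · simp
  · exact le_max_of_le_left (by linarith)
  · rw [max_le_iff, le_min_iff, le_min_iff]
    refine ⟨⟨by linarith, by linarith⟩, by linarith, by linarith⟩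
  · exact min_le_of_left_le (by linarith)
  · intro v hv
    rw [cpsi_eq b v hv]
    by_cases hvb : |v| ≤ b
    · have hv' := abs_le.1 hvb
      rw [if_pos hvb, one_mul, cpsi_eq c (w - v) (abs_le.2 ⟨by linarith, by linarith⟩)]
      refine if_congr ?_ rfl rfl
      rw [abs_le, max_le_iff, le_min_iff]
      constructor
      · rintro ⟨h1, h2⟩
        exact ⟨⟨by linarith, by linarith⟩, by linarith, by linarith⟩
      · rintro ⟨⟨h1, h2⟩, h3, h4⟩
        exact ⟨by linarith, by linarith⟩
    · rw [if_neg hvb, zero_mul, if_neg]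
      rintro ⟨h1, h2⟩
      rw [max_le_iff] at h1
      rw [le_min_iff] at h2
      exact hvb (abs_le.2 ⟨h1.1, h2.1⟩)

lemma cJ1 (d s w : ℝ) (hd : 0 < d) (hds : d ≤ s) (hs : s ≤ 1 / 4) (hw : |w| ≤ d) :
    cJ d s w = 2 * d - max 0 (|w| + d - s) := by
  rw [cJ_aux d s w (by linarith) (by linarith) (by linarith) (by linarith) (by linarith)]
  rcases abs_cases w with ⟨h1, h2⟩ | ⟨h1, h2⟩ <;> rw [h1] at hw ⊢ <;>
  rcases min_cases d (w + s) with ⟨h3, h4⟩ | ⟨h3, h4⟩ <;>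
  rcases max_cases (-d) (w - s) with ⟨h5, h6⟩ | ⟨h5, h6⟩ <;>
  rw [h3, h5]
  all_goals first
    | (rw [max_eq_left (by linarith)]; linarith)
    | (rw [max_eq_right (by linarith)]; linarith)

lemma cJ2 (d s w : ℝ) (hd : 0 < d) (hds : d ≤ s) (hs : s ≤ 1 / 4) (hw : |w| ≤ d) :
    cJ s d w = 2 * d - max 0 (|w| + d - s) := by
  rw [cJ_aux s d w (by linarith) (by linarith) (by linarith) (by linarith) (by linarith)]
  rcases abs_cases w with ⟨h1, h2⟩ | ⟨h1, h2⟩ <;> rw [h1] at hw ⊢ <;>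
  rcases min_cases s (w + d) with ⟨h3, h4⟩ | ⟨h3, h4⟩ <;>
  rcases max_cases (-s) (w - d) with ⟨h5, h6⟩ | ⟨h5, h6⟩ <;>
  rw [h3, h5]
  all_goals first
    | (rw [max_eq_left (by linarith)]; linarith)
    | (rw [max_eq_right (by linarith)]; linarith)

/-- area of `{|w| ≤ d, |v| ≤ d, |w - v| ≤ s}` -/
def cV (d s : ℝ) : ℝ := 4 * d ^ 2 - (max 0 (2 * d - s)) ^ 2

lemma cV_int (d s : ℝ) (hd : 0 < d) (hds : d ≤ s) :
    ∫ w in (-d)..d, (2 * d - max 0 (|w| + d - s)) = cV d s := by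
  have hcont : Continuous (fun w : ℝ => max 0 (|w| + d - s)) := by fun_prop
  rw [intervalIntegral.integral_sub (by simp) (hcont.intervalIntegrable _ _)]
  have hsym : ∫ w in (-d)..d, max 0 (|w| + d - s) = 2 * ∫ w in (0 : ℝ)..d, max 0 (|w| + d - s) := by
    rw [← intervalIntegral.integral_add_adjacent_intervals
      (hcont.intervalIntegrable (-d) 0) (hcont.intervalIntegrable 0 d)]
    have := intervalIntegral.integral_comp_neg (a := 0) (b := d) (fun w : ℝ => max 0 (|w| + d - s))
    simp only [abs_neg, neg_zero] at this
    rw [← this]; ring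
  have hhalf : ∫ w in (0 : ℝ)..d, max 0 (|w| + d - s) = (max 0 (2 * d - s)) ^ 2 / 2 := by
    rcases le_total (2 * d) s with h | h
    · rw [max_eq_left (by linarith)]
      rw [intervalIntegral.integral_congr (g := fun _ => 0)]
      · simp
      · intro w hw
        rw [Set.uIcc_of_le hd.le] at hw
        simp only
        rw [abs_of_nonneg hw.1, max_eq_left (by linarith [hw.2])]
    · rw [max_eq_right (by linarith)]
      rw [← intervalIntegral.integral_add_adjacent_intervals
        (hcont.intervalIntegrable 0 (s - d)) (hcont.intervalIntegrable (s - d) d)]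
      rw [intervalIntegral.integral_congr (g := fun _ => 0) (a := 0) (b := s - d)]
      · rw [intervalIntegral.integral_congr (g := fun w => w - (s - d)) (a := s - d) (b := d)]
        · rw [intervalIntegral.integral_sub (by simp) (by simp)]
          simp
          ring
        · intro w hw
          rw [Set.uIcc_of_le (by linarith)] at hw
          simp only
          rw [abs_of_nonneg (by linarith [hw.1]), max_eq_right (by linarith [hw.1])]
          ring
      · intro w hw
        rw [Set.uIcc_of_le (by linarith)] at hw
        simp only
        rw [abs_of_nonneg hw.1, max_eq_left (by linarith [hw.2])]
  rw [hsym, hhalf]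
  unfold cV
  simp
  ring

lemma cK_aux (d s b c : ℝ) (hd : 0 < d) (hds : d ≤ s) (hs : s ≤ 1 / 4)
    (hJ : ∀ w, |w| ≤ d → cJ b c w = 2 * d - max 0 (|w| + d - s)) (u : ℝ) :
    ∫ y, ∫ z, cpsi d (u - y) * cpsi c (y - z) * cpsi b (z - u) ∂lam ∂lam = cV d s := by
  have hJp : Function.Periodic (fun w => cpsi d w * cJ b c w) 1 := by
    intro w
    simp only [cJ]
    rw [cpsi_periodic d w]
    congr 2
    ext v
    rw [show w + 1 - v = (w - v) + 1 by ring, cpsi_periodic c]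
  have hin : ∀ y, ∫ z, cpsi d (u - y) * cpsi c (y - z) * cpsi b (z - u) ∂lam
      = cpsi d (u - y) * cJ b c (u - y) := by
    intro y
    have e : ∀ z, cpsi d (u - y) * cpsi c (y - z) * cpsi b (z - u)
        = cpsi d (u - y) * (cpsi b (u - z) * cpsi c ((u - y) - (u - z))) := by
      intro z
      rw [← cpsi_neg b (u - z), ← cpsi_neg c ((u - y) - (u - z))]
      rw [show -(u - z) = z - u by ring, show -((u - y) - (u - z)) = y - z by ring]
      ring
    simp only [e]
    rw [integral_const_mul]
    congr 1
    have := lam_shift (fun v => cpsi b v * cpsi c ((u - y) - v)) (by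
      intro v
      simp only
      rw [cpsi_periodic b v, ← cpsi_periodic c ((u - y) - (v + 1))]
      congr 2
      ring) u
    exact this
  simp only [hin]
  rw [lam_shift (fun w => cpsi d w * cJ b c w) hJp,
    int_indicator _ (fun w => 2 * d - max 0 (|w| + d - s)) (-d) d (by linarith) (by linarith) (by linarith)]
  · exact cV_int d s hd hds
  · intro v hv
    rw [cpsi_eq d v hv]
    simp only [← abs_le]
    by_cases h : |v| ≤ d
    · rw [if_pos h, if_pos h, hJ v h, one_mul]
    · rw [if_neg h, if_neg h, zero_mul]

lemma cK1 (d s : ℝ) (hd : 0 < d) (hds : d ≤ s) (hs : s ≤ 1 / 4) (u : ℝ) :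
    ∫ y, ∫ z, cpsi d (u - y) * cpsi s (y - z) * cpsi d (z - u) ∂lam ∂lam = cV d s :=
  cK_aux d s d s hd hds hs (fun w hw => cJ1 d s w hd hds hs hw) u

lemma cK2 (d s : ℝ) (hd : 0 < d) (hds : d ≤ s) (hs : s ≤ 1 / 4) (u : ℝ) :
    ∫ y, ∫ z, cpsi d (u - y) * cpsi d (y - z) * cpsi s (z - u) ∂lam ∂lam = cV d s :=
  cK_aux d s s d hd hds hs (fun w hw => cJ2 d s w hd hds hs hw) u

lemma cK3 (d s : ℝ) (hd : 0 < d) (hds : d ≤ s) (hs : s ≤ 1 / 4) (u : ℝ) :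
    ∫ y, ∫ z, cpsi s (u - y) * cpsi d (y - z) * cpsi d (z - u) ∂lam ∂lam = cV d s := by
  rw [integral_integral_swap, ← cK2 d s hd hds hs u]
  · congr 1; ext y; congr 1; ext z
    rw [← cpsi_neg s (u - z), ← cpsi_neg d (z - y), ← cpsi_neg d (y - u)]
    simp only [neg_sub]
    ring
  · refine Integrable.of_bound (by unfold Function.uncurry; fun_prop) 1 (ae_of_all _ fun z => ?_)
    simp only [Function.uncurry]
    rw [Real.norm_eq_abs, abs_of_nonneg (mul_nonneg (mul_nonneg (cpsi_nonneg _ _) (cpsi_nonneg _ _)) (cpsi_nonneg _ _))]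
    exact mul_le_one₀ (mul_le_one₀ (cpsi_le_one _ _) (cpsi_nonneg _ _) (cpsi_le_one _ _))
      (cpsi_nonneg _ _) (cpsi_le_one _ _)

/-! ### Concentration of triple sums -/

def tS (n : ℕ) (i : Fin n) : Finset (Fin n × Fin n) :=
  univ.filter fun t => i ≠ t.1 ∧ i ≠ t.2 ∧ t.1 ≠ t.2

lemma triple_eq (n : ℕ) (f : Fin n → Fin n → Fin n → ℝ) :
    (∑ i, ∑ j, ∑ k, if i ≠ j ∧ i ≠ k ∧ j ≠ k then f i j k else 0)
      = ∑ i, ∑ t ∈ tS n i, f i t.1 t.2 := by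
  refine Finset.sum_congr rfl fun i _ => ?_
  unfold tS
  rw [Finset.sum_filter, Fintype.sum_prod_type]

lemma triple_var (n : ℕ) (r : ℝ) (hr0 : 0 ≤ r) (hr : r ≤ 1 / 4)
    (H : Fin n → Fin n → Fin n → ℝ → ℝ → ℝ → ℝ)
    (hm : ∀ i j k, Measurable fun z : ℝ × ℝ × ℝ => H i j k z.1 z.2.1 z.2.2)
    (hH0 : ∀ i j k x y z, 0 ≤ H i j k x y z)
    (hHB : ∀ i j k x y z, H i j k x y z ≤ cpsi r (x - y) * cpsi r (x - z))
    (c : Fin n → Fin n → Fin n → ℝ)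
    (hc : ∀ i j k u, ∫ y, ∫ z, H i j k u y z ∂lam ∂lam = c i j k) :
    Integrable (fun X : Fin n → ℝ => (∑ i, ∑ t ∈ tS n i, (H i t.1 t.2 (X i) (X t.1) (X t.2) - c i t.1 t.2)) ^ 2)
      (gbmMeasure n) ∧
    ∫ X, (∑ i, ∑ t ∈ tS n i, (H i t.1 t.2 (X i) (X t.1) (X t.2) - c i t.1 t.2)) ^ 2 ∂(gbmMeasure n)
      ≤ (n : ℝ) ^ 2 * (4 * ((n : ℝ) ^ 3 * (2 * r) ^ 3 + (n : ℝ) ^ 2 * (2 * r) ^ 2)) := by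
  have hH1 : ∀ i j k x y z, |H i j k x y z| ≤ 1 := fun i j k x y z => by
    rw [abs_of_nonneg (hH0 _ _ _ _ _ _)]
    exact (hHB i j k x y z).trans (mul_le_one₀ (cpsi_le_one _ _) (cpsi_nonneg _ _) (cpsi_le_one _ _))
  have hYm : ∀ i (t : Fin n × Fin n), Measurable fun X : Fin n → ℝ => H i t.1 t.2 (X i) (X t.1) (X t.2) :=
    fun i t => (hm i t.1 t.2).comp (f := fun X : Fin n → ℝ => (X i, X t.1, X t.2)) (by fun_prop)
  have hTm : ∀ i, Measurable fun X : Fin n → ℝ =>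
      ∑ t ∈ tS n i, (H i t.1 t.2 (X i) (X t.1) (X t.2) - c i t.1 t.2) := fun i =>
    Finset.measurable_sum _ fun t _ => (hYm i t).sub_const _
  have hTb : ∀ i (X : Fin n → ℝ), |∑ t ∈ tS n i, (H i t.1 t.2 (X i) (X t.1) (X t.2) - c i t.1 t.2)|
      ≤ ∑ t ∈ tS n i, (1 + |c i t.1 t.2|) := fun i X =>
    (Finset.abs_sum_le_sum_abs _ _).trans (Finset.sum_le_sum fun t _ =>
      (abs_sub _ _).trans (by gcongr; exact hH1 _ _ _ _ _ _))
  have hT2i : ∀ i, Integrable (fun X : Fin n → ℝ =>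
      (∑ t ∈ tS n i, (H i t.1 t.2 (X i) (X t.1) (X t.2) - c i t.1 t.2)) ^ 2) (gbmMeasure n) := fun i =>
    Integrable.of_bound ((hTm i).pow_const 2).aestronglyMeasurable
      ((∑ t ∈ tS n i, (1 + |c i t.1 t.2|)) ^ 2) (ae_of_all _ fun X => by
        rw [norm_pow, Real.norm_eq_abs]
        exact pow_le_pow_left₀ (abs_nonneg _) (hTb i X) 2)
  have hSi : Integrable (fun X : Fin n → ℝ => (∑ i, ∑ t ∈ tS n i, (H i t.1 t.2 (X i) (X t.1) (X t.2) - c i t.1 t.2)) ^ 2)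
      (gbmMeasure n) :=
    Integrable.of_bound ((Finset.measurable_sum _ fun i _ => hTm i).pow_const 2).aestronglyMeasurable
      ((∑ i, ∑ t ∈ tS n i, (1 + |c i t.1 t.2|)) ^ 2) (ae_of_all _ fun X => by
        rw [norm_pow, Real.norm_eq_abs]
        exact pow_le_pow_left₀ (abs_nonneg _) ((Finset.abs_sum_le_sum_abs _ _).trans
          (Finset.sum_le_sum fun i _ => hTb i X)) 2)
  refine ⟨hSi, ?_⟩
  have hV : ∀ i, ∫ X, (∑ t ∈ tS n i, (H i t.1 t.2 (X i) (X t.1) (X t.2) - c i t.1 t.2)) ^ 2 ∂(gbmMeasure n)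
      ≤ 4 * ((n : ℝ) ^ 3 * (2 * r) ^ 3 + (n : ℝ) ^ 2 * (2 * r) ^ 2) := by
    intro i
    have hmp := resample n i
    have hcomp : Integrable (fun p : ℝ × (Fin n → ℝ) =>
        (∑ t ∈ tS n i, (H i t.1 t.2 (Function.update p.2 i p.1 i) (Function.update p.2 i p.1 t.1)
          (Function.update p.2 i p.1 t.2) - c i t.1 t.2)) ^ 2) (lam.prod (gbmMeasure n)) :=
      hmp.integrable_comp_of_integrable (hT2i i)
    rw [← hmp.map_eq, integral_map hmp.measurable.aemeasurable
      ((hTm i).pow_const 2).aestronglyMeasurable, integral_prod _ hcomp]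
    have hin : ∀ u, ∫ X : Fin n → ℝ, (∑ t ∈ tS n i, (H i t.1 t.2 (Function.update X i u i) (Function.update X i u t.1)
          (Function.update X i u t.2) - c i t.1 t.2)) ^ 2 ∂(gbmMeasure n) ≤
          4 * ((n : ℝ) ^ 3 * (2 * r) ^ 3 + (n : ℝ) ^ 2 * (2 * r) ^ 2) := by
      intro u
      have e : ∀ X : Fin n → ℝ, ∑ t ∈ tS n i, (H i t.1 t.2 (Function.update X i u i) (Function.update X i u t.1)
          (Function.update X i u t.2) - c i t.1 t.2) = ∑ t ∈ tS n i, (H i t.1 t.2 u (X t.1) (X t.2) - c i t.1 t.2) := by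
        intro X
        refine Finset.sum_congr rfl fun t ht => ?_
        have ht := (Finset.mem_filter.1 ht).2
        rw [Function.update_self, Function.update_of_ne ht.1.symm, Function.update_of_ne ht.2.1.symm]
      simp only [e]
      exact var_bound n (fun y => cpsi r (u - y)) (by fun_prop) (fun y => cpsi_nonneg _ _)
        (fun y => cpsi_sq _ _) (2 * r) (int_cpsi r hr0 hr u) (fun t y z => H i t.1 t.2 u y z)
        (fun t => (hm i t.1 t.2).comp (f := fun p : ℝ × ℝ => (u, p.1, p.2)) (by fun_prop))
        (fun t y z => hH0 _ _ _ _ _ _) (fun t y z => hHB _ _ _ _ _ _) (fun t => c i t.1 t.2)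
        (fun t => hc i t.1 t.2 u) (tS n i) (fun t ht => (Finset.mem_filter.1 ht).2.2.2)
    refine (integral_mono hcomp.integral_prod_left (integrable_const _) hin).trans ?_
    simp
  calc ∫ X, (∑ i, ∑ t ∈ tS n i, (H i t.1 t.2 (X i) (X t.1) (X t.2) - c i t.1 t.2)) ^ 2 ∂(gbmMeasure n)
      ≤ ∫ X, (n : ℝ) * ∑ i, (∑ t ∈ tS n i, (H i t.1 t.2 (X i) (X t.1) (X t.2) - c i t.1 t.2)) ^ 2 ∂(gbmMeasure n) := by
        refine integral_mono hSi ((integrable_finsetSum _ fun i _ => hT2i i).const_mul _) fun X => ?_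
        have := sq_sum_le_card_mul_sum_sq (s := (univ : Finset (Fin n)))
          (f := fun i => ∑ t ∈ tS n i, (H i t.1 t.2 (X i) (X t.1) (X t.2) - c i t.1 t.2))
        simpa using this
    _ = (n : ℝ) * ∑ i, ∫ X, (∑ t ∈ tS n i, (H i t.1 t.2 (X i) (X t.1) (X t.2) - c i t.1 t.2)) ^ 2 ∂(gbmMeasure n) := by
        rw [integral_const_mul, integral_finsetSum _ (fun i _ => hT2i i)]
    _ ≤ (n : ℝ) * ∑ _i : Fin n, 4 * ((n : ℝ) ^ 3 * (2 * r) ^ 3 + (n : ℝ) ^ 2 * (2 * r) ^ 2) := by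
        gcongr with i
        exact hV i
    _ = _ := by
        simp
        ring

/-- Deterministic comparison of sums over distinct triples with sums over all triples. -/
lemma triple_det (n : ℕ) (c : Fin n → Fin n → Fin n → ℝ) (M : ℝ)
    (hc : ∀ i j k, |c i j k| ≤ M) :
    |∑ i, ∑ t ∈ tS n i, c i t.1 t.2 - ∑ i, ∑ j, ∑ k, c i j k| ≤ 3 * (n : ℝ) ^ 2 * M := by
  rw [← triple_eq]
  simp only [← Finset.sum_sub_distrib]
  have hp : ∀ i j k, |(if i ≠ j ∧ i ≠ k ∧ j ≠ k then c i j k else 0) - c i j k|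
      ≤ (if i = j then M else 0) + (if i = k then M else 0) + (if j = k then M else 0) := by
    intro i j k
    have h := hc i j k
    have hM := (abs_nonneg _).trans h
    by_cases h1 : i = j <;> by_cases h2 : i = k <;> by_cases h3 : j = k <;> simp [h1, h2, h3] <;>
      simp_all <;> linarith [hc k k k]
  calc _ ≤ ∑ i : Fin n, ∑ j : Fin n, ∑ k : Fin n,
      ((if i = j then M else 0) + (if i = k then M else 0) + (if j = k then M else 0)) := by
        refine (Finset.abs_sum_le_sum_abs _ _).trans (Finset.sum_le_sum fun i _ => ?_)
        refine (Finset.abs_sum_le_sum_abs _ _).trans (Finset.sum_le_sum fun j _ => ?_)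
        refine (Finset.abs_sum_le_sum_abs _ _).trans (Finset.sum_le_sum fun k _ => ?_)
        exact hp i j k
    _ = 3 * (n : ℝ) ^ 2 * M := by
        simp only [Finset.sum_add_distrib]
        have : ∀ i : Fin n, (∑ x : Fin n, ∑ _y : Fin n, if i = x then M else 0) = n * M := by
          intro i
          rw [Finset.sum_comm]; simp
        simp only [this]
        simp
        ring

/-- Chebyshev bound. -/
lemma triple_prob (n : ℕ) (hn : 0 < n) (r : ℝ) (hr0 : 0 < r) (hr : r ≤ 1 / 4)
    (H : Fin n → Fin n → Fin n → ℝ → ℝ → ℝ → ℝ)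
    (hm : ∀ i j k, Measurable fun z : ℝ × ℝ × ℝ => H i j k z.1 z.2.1 z.2.2)
    (hH0 : ∀ i j k x y z, 0 ≤ H i j k x y z)
    (hHB : ∀ i j k x y z, H i j k x y z ≤ cpsi r (x - y) * cpsi r (x - z))
    (c : Fin n → Fin n → Fin n → ℝ)
    (hc : ∀ i j k u, ∫ y, ∫ z, H i j k u y z ∂lam ∂lam = c i j k)
    (hcb : ∀ i j k, |c i j k| ≤ 4 * r ^ 2)
    (δ : ℝ) (hδ : 0 < δ) (hx : 6 ≤ δ * (n * r)) :
    (gbmMeasure n).real {X | δ * ((n : ℝ) ^ 3 * r ^ 2) ≤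
      |(∑ i, ∑ j, ∑ k, if i ≠ j ∧ i ≠ k ∧ j ≠ k then H i j k (X i) (X j) (X k) else 0)
        - ∑ i, ∑ j, ∑ k, c i j k|}
      ≤ (16 / δ ^ 2) * (8 / (n * r) + 4 / (n * r) ^ 2) := by
  obtain ⟨hi, hv⟩ := triple_var n r hr0.le hr H hm hH0 hHB c hc
  have hd := triple_det n c _ hcb
  have hn' : (0 : ℝ) < n := by exact_mod_cast hn
  set q : ℝ := (n : ℝ) ^ 3 * r ^ 2 with hq
  have hq0 : 0 < q := by positivity
  have hd2 : 3 * (n : ℝ) ^ 2 * (4 * r ^ 2) ≤ δ / 2 * q := by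
    have h1 : δ * (n * r) ≤ δ * (n * (1 / 4)) := by gcongr
    have h2 : 24 ≤ δ * n := by linarith
    have h3 : 0 ≤ (n : ℝ) ^ 2 * r ^ 2 := by positivity
    rw [hq]
    nlinarith
  set F : (Fin n → ℝ) → ℝ := fun X =>
    (∑ i, ∑ t ∈ tS n i, (H i t.1 t.2 (X i) (X t.1) (X t.2) - c i t.1 t.2)) ^ 2 with hF
  have hsub : {X : Fin n → ℝ | δ * q ≤
      |(∑ i, ∑ j, ∑ k, if i ≠ j ∧ i ≠ k ∧ j ≠ k then H i j k (X i) (X j) (X k) else 0)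
        - ∑ i, ∑ j, ∑ k, c i j k|} ⊆ {X | (δ / 2 * q) ^ 2 ≤ F X} := by
    intro X hX
    simp only [Set.mem_ofPred_eq] at hX ⊢
    rw [triple_eq n (fun i j k => H i j k (X i) (X j) (X k))] at hX
    have hA : δ / 2 * q ≤ |∑ i, ∑ t ∈ tS n i, (H i t.1 t.2 (X i) (X t.1) (X t.2) - c i t.1 t.2)| := by
      simp only [Finset.sum_sub_distrib]
      have := abs_sub_le (∑ i, ∑ t ∈ tS n i, H i t.1 t.2 (X i) (X t.1) (X t.2))
        (∑ i, ∑ t ∈ tS n i, c i t.1 t.2) (∑ i, ∑ j, ∑ k, c i j k)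
      linarith
    rw [hF]
    simp only
    rw [← sq_abs (∑ i, ∑ t ∈ tS n i, (H i t.1 t.2 (X i) (X t.1) (X t.2) - c i t.1 t.2))]
    exact pow_le_pow_left₀ (by positivity) hA 2
  have hmk := mul_meas_ge_le_integral_of_nonneg (μ := gbmMeasure n) (f := F)
    (ae_of_all _ fun X => sq_nonneg _) hi ((δ / 2 * q) ^ 2)
  have h3 := (measureReal_mono hsub (measure_ne_top (gbmMeasure n) _))
  refine h3.trans ?_
  have hpos : 0 < (δ / 2 * q) ^ 2 := by positivity
  refine le_of_mul_le_mul_left ((hmk.trans hv).trans (le_of_eq ?_)) hpos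
  rw [hq]
  field_simp
  ring

/-! ### Specialisation to the block model -/

def bcom (k : ℕ) (i : Fin (2 * k)) : Bool := decide ((i : ℕ) < k)

def brad (s d : ℝ) (α β : Bool) : ℝ := if α = β then s else d

lemma sum_bcom (k : ℕ) (f : Bool → ℝ) :
    ∑ i : Fin (2 * k), f (bcom k i) = k * (f true + f false) := by
  have h := Finset.sum_range (n := 2 * k) (fun i => f (decide (i < k)))
  unfold bcom
  rw [← h, two_mul, Finset.sum_range_add]
  have h1 : ∑ x ∈ Finset.range k, f (decide (x < k)) = ∑ x ∈ Finset.range k, f true :=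
    Finset.sum_congr rfl fun x hx => by simp [Finset.mem_range.1 hx]
  rw [h1]
  simp
  ring

def triH (s d : ℝ) (α β γ : Bool) (x y z : ℝ) : ℝ :=
  cpsi (brad s d α β) (x - y) * cpsi (brad s d β γ) (y - z) * cpsi (brad s d γ α) (z - x)

def pathH (s d : ℝ) (α β γ : Bool) (x y z : ℝ) : ℝ :=
  cpsi (brad s d α β) (x - y) * cpsi (brad s d α γ) (x - z)

def triC (s d : ℝ) (α β γ : Bool) : ℝ := if α = β ∧ α = γ then cV s s else cV d s

def pathC (s d : ℝ) (α β γ : Bool) : ℝ := 4 * brad s d α β * brad s d α γ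

lemma brad_le {s d : ℝ} (h : d ≤ s) (α β : Bool) : brad s d α β ≤ s := by
  unfold brad; split_ifs <;> linarith

lemma brad_pos {s d : ℝ} (hd : 0 < d) (h : d ≤ s) (α β : Bool) : 0 < brad s d α β := by
  unfold brad; split_ifs <;> linarith

lemma triH_int (s d : ℝ) (hd : 0 < d) (hds : d ≤ s) (hs : s ≤ 1 / 4) (α β γ : Bool) (u : ℝ) :
    ∫ y, ∫ z, triH s d α β γ u y z ∂lam ∂lam = triC s d α β γ := by
  have h0 := cK1 s s (hd.trans_le hds) le_rfl hs u
  have h1 := cK1 d s hd hds hs u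
  have h2 := cK2 d s hd hds hs u
  have h3 := cK3 d s hd hds hs u
  unfold triH triC
  cases α <;> cases β <;> cases γ <;> simpa [brad]

lemma pathH_int (s d : ℝ) (hd : 0 < d) (hds : d ≤ s) (hs : s ≤ 1 / 4) (α β γ : Bool) (u : ℝ) :
    ∫ y, ∫ z, pathH s d α β γ u y z ∂lam ∂lam = pathC s d α β γ := by
  unfold pathH pathC
  simp only [integral_const_mul, integral_mul_const]
  rw [int_cpsi _ (brad_pos hd hds _ _).le ((brad_le hds _ _).trans hs),
    int_cpsi _ (brad_pos hd hds _ _).le ((brad_le hds _ _).trans hs)]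
  ring

lemma cV_nonneg (d s : ℝ) (hd : 0 < d) (hds : d ≤ s) : 0 ≤ cV d s := by
  unfold cV
  have h1 : max 0 (2 * d - s) ≤ 2 * d := max_le (by linarith) (by linarith)
  have h2 : 0 ≤ max 0 (2 * d - s) := le_max_left _ _
  nlinarith

lemma cV_le (d s : ℝ) (hd : 0 < d) (hds : d ≤ s) : cV d s ≤ 4 * s ^ 2 := by
  unfold cV
  nlinarith [sq_nonneg (max 0 (2 * d - s))]

lemma triC_abs (s d : ℝ) (hd : 0 < d) (hds : d ≤ s) (α β γ : Bool) :
    |triC s d α β γ| ≤ 4 * s ^ 2 := by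
  unfold triC
  split_ifs
  · rw [abs_of_nonneg (cV_nonneg s s (hd.trans_le hds) le_rfl)]
    exact cV_le s s (hd.trans_le hds) le_rfl
  · rw [abs_of_nonneg (cV_nonneg d s hd hds)]
    exact cV_le d s hd hds

lemma pathC_abs (s d : ℝ) (hd : 0 < d) (hds : d ≤ s) (α β γ : Bool) :
    |pathC s d α β γ| ≤ 4 * s ^ 2 := by
  unfold pathC
  have h1 := brad_pos hd hds α β
  have h2 := brad_pos hd hds α γ
  have h3 := brad_le hds α β
  have h4 := brad_le hds α γ
  rw [abs_of_nonneg (by positivity)]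
  nlinarith

lemma sum_bcom3 (k : ℕ) (f : Bool → Bool → Bool → ℝ) :
    ∑ i, ∑ j, ∑ l, f (bcom k i) (bcom k j) (bcom k l)
      = (k : ℝ) * ((k : ℝ) * ((k : ℝ) * (f true true true + f true true false) +
          (k : ℝ) * (f true false true + f true false false)) +
        (k : ℝ) * ((k : ℝ) * (f false true true + f false true false) +
          (k : ℝ) * (f false false true + f false false false))) := by
  have h1 : ∀ i j, ∑ l, f (bcom k i) (bcom k j) (bcom k l) = _ := fun i j =>
    sum_bcom k (fun γ => f (bcom k i) (bcom k j) γ)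
  simp only [h1]
  have h2 : ∀ i, ∑ j, (k : ℝ) * (f (bcom k i) (bcom k j) true + f (bcom k i) (bcom k j) false) = _ :=
    fun i => sum_bcom k (fun β => (k : ℝ) * (f (bcom k i) β true + f (bcom k i) β false))
  simp only [h2]
  exact sum_bcom k (fun α => (k : ℝ) * ((k : ℝ) * (f α true true + f α true false) +
    (k : ℝ) * (f α false true + f α false false)))

lemma triC_sum (s d : ℝ) (k : ℕ) :
    ∑ i, ∑ j, ∑ l, triC s d (bcom k i) (bcom k j) (bcom k l)
      = (k : ℝ) ^ 3 * (2 * cV s s + 6 * cV d s) := by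
  rw [sum_bcom3 k (triC s d)]
  simp [triC]
  ring

lemma pathC_sum (s d : ℝ) (k : ℕ) :
    ∑ i, ∑ j, ∑ l, pathC s d (bcom k i) (bcom k j) (bcom k l)
      = 8 * (k : ℝ) ^ 3 * (s + d) ^ 2 := by
  rw [sum_bcom3 k (pathC s d)]
  simp [pathC, brad]
  ring

lemma gbmA_eq_s13 (k : ℕ) (s d : ℝ) (X : Fin (2 * k) → ℝ) (hX : ∀ i, X i ∈ Set.Icc (0 : ℝ) 1)
    (i j : Fin (2 * k)) (hij : i ≠ j) :
    gbmA (2 * k) k s d X i j = cpsi (brad s d (bcom k i) (bcom k j)) (X i - X j) := by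
  unfold gbmA cpsi brad bcom
  rw [if_neg hij, cD_pdist (hX i) (hX j)]
  simp only [decide_eq_decide]
  by_cases h : ((i : ℕ) < k ↔ (j : ℕ) < k)
  · simp only [if_pos h]
  · simp only [if_neg h]

lemma triSum_eq (k : ℕ) (s d : ℝ) (X : Fin (2 * k) → ℝ) (hX : ∀ i, X i ∈ Set.Icc (0 : ℝ) 1) :
    triSum (2 * k) k s d X = ∑ i, ∑ j, ∑ l, if i ≠ j ∧ i ≠ l ∧ j ≠ l then
      triH s d (bcom k i) (bcom k j) (bcom k l) (X i) (X j) (X l) else 0 := by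
  unfold triSum
  refine Finset.sum_congr rfl fun i _ => Finset.sum_congr rfl fun j _ =>
    Finset.sum_congr rfl fun l _ => ?_
  split_ifs with h
  · rw [gbmA_eq_s13 k s d X hX i j h.1, gbmA_eq_s13 k s d X hX j l h.2.2, gbmA_eq_s13 k s d X hX l i h.2.1.symm]
    rfl
  · rfl

lemma pathSum_eq (k : ℕ) (s d : ℝ) (X : Fin (2 * k) → ℝ) (hX : ∀ i, X i ∈ Set.Icc (0 : ℝ) 1) :
    pathSum (2 * k) k s d X = ∑ i, ∑ j, ∑ l, if i ≠ j ∧ i ≠ l ∧ j ≠ l then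
      pathH s d (bcom k i) (bcom k j) (bcom k l) (X i) (X j) (X l) else 0 := by
  unfold pathSum
  refine Finset.sum_congr rfl fun i _ => Finset.sum_congr rfl fun j _ =>
    Finset.sum_congr rfl fun l _ => ?_
  split_ifs with h
  · rw [gbmA_eq_s13 k s d X hX i j h.1, gbmA_eq_s13 k s d X hX i l h.2.1]
    rfl
  · rfl

lemma gbm_ae (n : ℕ) : ∀ᵐ X ∂(gbmMeasure n), ∀ i, X i ∈ Set.Icc (0 : ℝ) 1 := by
  rw [ae_all_iff]
  intro i
  have h : ∀ᵐ x ∂lam, x ∈ Set.Icc (0 : ℝ) 1 := ae_restrict_mem measurableSet_Icc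
  exact (measurePreserving_eval (fun _ : Fin n => lam) i).quasiMeasurePreserving.ae h

lemma ratio_close (T P t p q δ : ℝ) (hq : 0 < q) (hδ : 0 < δ) (hδ2 : δ ≤ 1 / 2)
    (hT : |T - t| < δ * q) (hP : |P - p| < δ * q) (hqp : q ≤ p) (ht0 : 0 ≤ t) (htp : t ≤ 3 * p) :
    |T / P - t / p| ≤ 8 * δ := by
  have hp : 0 < p := hq.trans_le hqp
  have hP2 : q / 2 < P := by
    have := (abs_lt.1 hP).1
    nlinarith
  have hP0 : 0 < P := by linarith
  have e : T / P - t / p = ((T - t) * p - t * (P - p)) / (P * p) := by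
    field_simp; ring
  rw [e, abs_div, abs_of_pos (mul_pos hP0 hp), div_le_iff₀ (mul_pos hP0 hp)]
  calc |(T - t) * p - t * (P - p)| ≤ |(T - t) * p| + |t * (P - p)| := abs_sub _ _
    _ = |T - t| * p + t * |P - p| := by rw [abs_mul, abs_mul, abs_of_pos hp, abs_of_nonneg ht0]
    _ ≤ (δ * q) * p + (3 * p) * (δ * q) := by gcongr
    _ = 8 * δ * (q / 2 * p) := by ring
    _ ≤ 8 * δ * (P * p) := by gcongr

lemma L_eq (s d : ℝ) (hd : 0 < d) (hds : d ≤ s) (k : ℕ) (hk : 0 < k) :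
    (if s < 2 * d then 3 * s * d / (s + d) ^ 2
      else 3 * (s ^ 2 + 4 * d ^ 2) / (4 * (s + d) ^ 2)) =
    ((k : ℝ) ^ 3 * (2 * cV s s + 6 * cV d s)) / (8 * (k : ℝ) ^ 3 * (s + d) ^ 2) := by
  have hk' : (0 : ℝ) < k := by exact_mod_cast hk
  have hsd : 0 < s + d := by linarith
  unfold cV
  rw [max_eq_right (show 0 ≤ 2 * s - s by linarith)]
  split_ifs with h
  · rw [max_eq_right (show 0 ≤ 2 * d - s by linarith)]
    field_simp
    ring
  · rw [max_eq_left (show 2 * d - s ≤ 0 by linarith)]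
    field_simp
    ring

lemma main_bound (k : ℕ) (hk : 0 < k) (s d : ℝ) (hd : 0 < d) (hds : d ≤ s) (hs : s ≤ 1 / 4)
    (δ : ℝ) (hδ : 0 < δ) (hδ2 : δ ≤ 1 / 2) (hx : 6 ≤ δ * (((2 * k : ℕ) : ℝ) * s)) (ε : ℝ)
    (hε : 8 * δ ≤ ε) (L : ℝ)
    (hL : L = if s < 2 * d then 3 * s * d / (s + d) ^ 2
      else 3 * (s ^ 2 + 4 * d ^ 2) / (4 * (s + d) ^ 2)) :
    gbmMeasure (2 * k) {X | ε < |globalCC (2 * k) k s d X - L|} ≤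
      ENNReal.ofReal (2 * ((16 / δ ^ 2) *
        (8 / (((2 * k : ℕ) : ℝ) * s) + 4 / (((2 * k : ℕ) : ℝ) * s) ^ 2))) := by
  have hs0 : 0 < s := hd.trans_le hds
  have hk' : (0 : ℝ) < k := by exact_mod_cast hk
  have b1 := triple_prob (2 * k) (by omega) s hs0 hs
    (fun i j l => triH s d (bcom k i) (bcom k j) (bcom k l))
    (fun i j l => by unfold triH; fun_prop)
    (fun i j l x y z => mul_nonneg (mul_nonneg (cpsi_nonneg _ _) (cpsi_nonneg _ _)) (cpsi_nonneg _ _))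
    (fun i j l x y z => by
      unfold triH
      have h1 := cpsi_mono (brad_le hds (bcom k i) (bcom k j)) (x - y)
      have h2 := cpsi_mono (brad_le hds (bcom k l) (bcom k i)) (z - x)
      rw [← cpsi_neg s (z - x), neg_sub] at h2
      refine mul_le_mul ?_ h2 (cpsi_nonneg _ _) (cpsi_nonneg _ _)
      exact (mul_le_of_le_one_right (cpsi_nonneg _ _) (cpsi_le_one _ _)).trans h1)
    (fun i j l => triC s d (bcom k i) (bcom k j) (bcom k l))
    (fun i j l u => triH_int s d hd hds hs _ _ _ u)
    (fun i j l => triC_abs s d hd hds _ _ _) δ hδ hx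
  have b2 := triple_prob (2 * k) (by omega) s hs0 hs
    (fun i j l => pathH s d (bcom k i) (bcom k j) (bcom k l))
    (fun i j l => by unfold pathH; fun_prop)
    (fun i j l x y z => mul_nonneg (cpsi_nonneg _ _) (cpsi_nonneg _ _))
    (fun i j l x y z => mul_le_mul (cpsi_mono (brad_le hds _ _) _) (cpsi_mono (brad_le hds _ _) _)
      (cpsi_nonneg _ _) (cpsi_nonneg _ _))
    (fun i j l => pathC s d (bcom k i) (bcom k j) (bcom k l))
    (fun i j l u => pathH_int s d hd hds hs _ _ _ u)
    (fun i j l => pathC_abs s d hd hds _ _ _) δ hδ hx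
  rw [triC_sum] at b1
  rw [pathC_sum] at b2
  rw [L_eq s d hd hds k hk] at hL
  set E1 := {X : Fin (2 * k) → ℝ | δ * (((2 * k : ℕ) : ℝ) ^ 3 * s ^ 2) ≤
      |(∑ i, ∑ j, ∑ l, if i ≠ j ∧ i ≠ l ∧ j ≠ l then
        triH s d (bcom k i) (bcom k j) (bcom k l) (X i) (X j) (X l) else 0)
        - (k : ℝ) ^ 3 * (2 * cV s s + 6 * cV d s)|} with hE1
  set E2 := {X : Fin (2 * k) → ℝ | δ * (((2 * k : ℕ) : ℝ) ^ 3 * s ^ 2) ≤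
      |(∑ i, ∑ j, ∑ l, if i ≠ j ∧ i ≠ l ∧ j ≠ l then
        pathH s d (bcom k i) (bcom k j) (bcom k l) (X i) (X j) (X l) else 0)
        - 8 * (k : ℝ) ^ 3 * (s + d) ^ 2|} with hE2
  have hle : gbmMeasure (2 * k) {X | ε < |globalCC (2 * k) k s d X - L|} ≤
      gbmMeasure (2 * k) (E1 ∪ E2) := by
    refine measure_mono_ae ?_
    filter_upwards [gbm_ae (2 * k)] with X hX
    intro hX2
    by_contra hcon
    have hX2' : ε < |globalCC (2 * k) k s d X - L| := hX2
    have hcon' : ¬ (X ∈ E1 ∪ E2) := hcon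
    rw [Set.mem_union, not_or] at hcon'
    obtain ⟨n1, n2⟩ := hcon'
    rw [hE1, Set.mem_ofPred_eq, not_le, ← triSum_eq k s d X hX] at n1
    rw [hE2, Set.mem_ofPred_eq, not_le, ← pathSum_eq k s d X hX] at n2
    have hV1 := cV_nonneg s s hs0 le_rfl
    have hV2 := cV_nonneg d s hd hds
    have hV3 := cV_le s s hs0 le_rfl
    have hV4 := cV_le d s hd hds
    have := ratio_close _ _ _ _ _ δ (by positivity) hδ hδ2 n1 n2 (by
        push_cast
        have : s ^ 2 ≤ (s + d) ^ 2 := by gcongr; linarith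
        have h3 : 0 < (k : ℝ) ^ 3 := by positivity
        nlinarith) (by positivity) (by
        have h3 : 0 < (k : ℝ) ^ 3 := by positivity
        have h4 : 2 * cV s s + 6 * cV d s ≤ 24 * (s + d) ^ 2 := by
          unfold cV
          nlinarith [sq_nonneg (max 0 (2 * d - s)), sq_nonneg (max 0 (2 * s - s))]
        nlinarith)
    rw [← hL] at this
    unfold globalCC at hX2'
    linarith
  refine hle.trans ?_
  rw [← ofReal_measureReal (measure_ne_top _ _)]
  refine ENNReal.ofReal_le_ofReal ((measureReal_union_le _ _).trans ?_)
  linarith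

/-- Global clustering coefficient of the balanced GBM (`τ = 1/2`, i.e. `n = 2k`
nodes with communities of size `k`): under `r_s = Θ(r_d)` and `n r_s → ∞`, the
global clustering coefficient converges in probability to `3 r_s r_d/(r_s+r_d)²`
when `r_s < 2 r_d` and to `3(r_s² + 4r_d²)/(4(r_s+r_d)²)` when `r_s ≥ 2 r_d`. -/
theorem globalCC_limit_balanced (rs rd : ℕ → ℝ)
    (hrd : ∀ k, 0 < rd k) (hds : ∀ k, rd k ≤ rs k) (hs4 : ∀ k, rs k ≤ 1 / 4)
    (hTheta : ∃ c₁ c₂ : ℝ, 0 < c₁ ∧ 0 < c₂ ∧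
      ∀ᶠ k in Filter.atTop, c₁ * rd k ≤ rs k ∧ rs k ≤ c₂ * rd k)
    (hdeg : Filter.Tendsto (fun k : ℕ => ((2 * k : ℕ) : ℝ) * rs k)
      Filter.atTop Filter.atTop)
    (L : ℕ → ℝ)
    (hL : ∀ k, L k =
      if rs k < 2 * rd k then 3 * rs k * rd k / (rs k + rd k) ^ 2
      else 3 * (rs k ^ 2 + 4 * rd k ^ 2) / (4 * (rs k + rd k) ^ 2)) :
    ∀ ε : ℝ, 0 < ε →
      Filter.Tendsto
        (fun k => gbmMeasure (2 * k)
          {X | ε < |globalCC (2 * k) k (rs k) (rd k) X - L k|})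
        Filter.atTop (nhds 0) := by
  intro ε hε
  set δ : ℝ := min (1 / 2) (ε / 8) with hδdef
  have hδ : 0 < δ := lt_min (by norm_num) (by linarith)
  have hδ2 : δ ≤ 1 / 2 := min_le_left _ _
  have hδ3 : 8 * δ ≤ ε := by
    have : δ ≤ ε / 8 := min_le_right _ _
    linarith
  have hlim : Filter.Tendsto (fun k : ℕ => ENNReal.ofReal (2 * ((16 / δ ^ 2) *
        (8 / (((2 * k : ℕ) : ℝ) * rs k) + 4 / (((2 * k : ℕ) : ℝ) * rs k) ^ 2))))
      Filter.atTop (nhds 0) := by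
    have h1 : Filter.Tendsto (fun k : ℕ => 8 / (((2 * k : ℕ) : ℝ) * rs k)) Filter.atTop (nhds 0) :=
      hdeg.const_div_atTop 8
    have h2 : Filter.Tendsto (fun k : ℕ => 4 / (((2 * k : ℕ) : ℝ) * rs k) ^ 2)
        Filter.atTop (nhds 0) :=
      ((Filter.tendsto_pow_atTop (two_ne_zero)).comp hdeg).const_div_atTop 4
    have h3 := ((h1.add h2).const_mul (16 / δ ^ 2)).const_mul 2
    have h4 := ENNReal.tendsto_ofReal h3
    simpa using h4
  refine tendsto_of_tendsto_of_tendsto_of_le_of_le' tendsto_const_nhds hlim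
    (Filter.Eventually.of_forall fun k => zero_le) ?_
  filter_upwards [hdeg.eventually_ge_atTop (6 / δ), Filter.eventually_gt_atTop 0] with k hk hk0
  refine main_bound k hk0 (rs k) (rd k) (hrd k) (hds k) (hs4 k) δ hδ hδ2 ?_ ε hδ3 (L k) (hL k)
  rw [div_le_iff₀ hδ] at hk
  linarith
end
end
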